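/- arXiv:0705.2437 — 2 statements merged into one kernel-verified Lean document; each statement's English description precedes it below -/
import Mathlib

section
/- Observational substate lemma for a fixed measurement: Let m ≥ n, let ρ and σ be quantum states on ℂ^n with supp(ρ) ⊆ supp(σ), let ψ be a purification of ρ in ℂ^n ⊗ ℂ^m, let F be a POVM element on ℂ^n ⊗ ℂ^m, and let β > 1 be real. Set p := Tr(F·|ψ⟩⟨ψ|) and k' := β·D(ρ‖σ) − 2·logb 2 (1 − β^{−1/2}), and assume p > 0. Then there exists a purification φ of σ in ℂ^n ⊗ ℂ^m such that Tr(F·|φ⟩⟨φ|) ≥ p / 2^{k'/p}. -/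
open Matrix BigOperators
open scoped ComplexOrder

noncomputable section

/-- A quantum state: positive semidefinite matrix with unit trace. -/
def IsState {d : Type*} [Fintype d] (ρ : Matrix d d ℂ) : Prop :=
  ρ.PosSemidef ∧ ρ.trace = 1

/-- `SuppLE ρ σ` : the support of `ρ` is contained in the support of `σ`,
expressed as inclusion of kernels the other way. -/
def SuppLE {d : Type*} [Fintype d] (ρ σ : Matrix d d ℂ) : Prop :=
  ∀ v : d → ℂ, σ *ᵥ v = 0 → ρ *ᵥ v = 0

/-- Matrix logarithm: apply `Real.log` to the eigenvalues (with `log 0 = 0`). -/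
noncomputable def matLog {d : Type*} [Fintype d] [DecidableEq d]
    (ρ : Matrix d d ℂ) : Matrix d d ℂ :=
  if h : ρ.IsHermitian then
    (h.eigenvectorUnitary : Matrix d d ℂ) *
      Matrix.diagonal (fun i => (Real.log (h.eigenvalues i) : ℂ)) *
      (star (h.eigenvectorUnitary : Matrix d d ℂ))
  else 0

/-- Quantum relative entropy `S(ρ‖σ) = Re Tr (ρ (log ρ - log σ))`. -/
noncomputable def relEnt {d : Type*} [Fintype d] [DecidableEq d]
    (ρ σ : Matrix d d ℂ) : ℝ :=
  (Matrix.trace (ρ * (matLog ρ - matLog σ))).re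

/-- Trace norm of a Hermitian matrix: sum of absolute values of eigenvalues. -/
noncomputable def traceNorm {d : Type*} [Fintype d] [DecidableEq d]
    (A : Matrix d d ℂ) : ℝ :=
  if h : A.IsHermitian then ∑ i, |h.eigenvalues i| else 0

/-- Rank-one operator `|ψ⟩⟨ψ|`. -/
def ketbra {d : Type*} (ψ : d → ℂ) : Matrix d d ℂ :=
  Matrix.of fun a b => ψ a * (starRingEnd ℂ) (ψ b)

/-- A POVM element: a positive semidefinite matrix `F` with `1 - F` positive semidefinite. -/
def IsPOVMElem {d : Type*} [Fintype d] [DecidableEq d] (F : Matrix d d ℂ) : Prop :=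
  F.PosSemidef ∧ ((1 : Matrix d d ℂ) - F).PosSemidef

/-- `trR F ρ = Re Tr (F ρ)`. -/
noncomputable def trR {d : Type*} [Fintype d] (F ρ : Matrix d d ℂ) : ℝ :=
  (Matrix.trace (F * ρ)).re

/-- Observational divergence `D(ρ‖σ)`. -/
noncomputable def obsDiv {d : Type*} [Fintype d] [DecidableEq d]
    (ρ σ : Matrix d d ℂ) : ℝ :=
  sSup {x : ℝ | ∃ F : Matrix d d ℂ, IsPOVMElem F ∧ trR F σ ≠ 0 ∧
    x = trR F ρ * Real.logb 2 (trR F ρ / trR F σ)}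

/-- A probability distribution on `Fin n`. -/
def IsProbDist {n : ℕ} (P : Fin n → ℝ) : Prop :=
  (∀ i, 0 ≤ P i) ∧ ∑ i, P i = 1

/-- Classical relative entropy (base 2); terms with `P i = 0` contribute `0`. -/
noncomputable def cRelEnt {n : ℕ} (P Q : Fin n → ℝ) : ℝ :=
  ∑ i, P i * Real.logb 2 (P i / Q i)

/-- Classical observational divergence. -/
noncomputable def cObsDiv {n : ℕ} (P Q : Fin n → ℝ) : ℝ :=
  sSup {x : ℝ | ∃ f : Fin n → ℝ, (∀ i, 0 ≤ f i ∧ f i ≤ 1) ∧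
    (∑ i, f i * Q i) ≠ 0 ∧
    x = (∑ i, f i * P i) * Real.logb 2 ((∑ i, f i * P i) / (∑ i, f i * Q i))}


section helpers

lemma spec_form {n : ℕ} {A : Matrix (Fin n) (Fin n) ℂ} (hA : A.PosSemidef) :
    ∃ (E : Matrix (Fin n) (Fin n) ℂ) (d : Fin n → ℝ), E * Eᴴ = 1 ∧ Eᴴ * E = 1 ∧ (∀ i, 0 ≤ d i) ∧
      A = E * Matrix.diagonal (fun i => (d i : ℂ)) * Eᴴ := by
  refine ⟨hA.1.eigenvectorUnitary, hA.1.eigenvalues, ?_, ?_, hA.eigenvalues_nonneg, ?_⟩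
  · exact Unitary.coe_mul_star_self _
  · exact Unitary.coe_star_mul_self _
  · have := hA.1.spectral_theorem
    rw [Unitary.conjStarAlgAut_apply] at this
    exact this

lemma polar {n m : ℕ} (hnm : n ≤ m) (N : Matrix (Fin n) (Fin m) ℂ) :
    ∃ (H : Matrix (Fin n) (Fin n) ℂ) (V : Matrix (Fin n) (Fin m) ℂ), H.PosSemidef ∧
      V * Vᴴ = 1 ∧ N = H * V := by
  obtain ⟨E, d, hE1, hE2, hd, hN⟩ := spec_form (posSemidef_self_mul_conjTranspose N)
  set W := Eᴴ * N with hW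
  have hWW : W * Wᴴ = Matrix.diagonal (fun i => (d i : ℂ)) := by
    rw [hW, conjTranspose_mul, conjTranspose_conjTranspose,
      show Eᴴ * N * (Nᴴ * E) = Eᴴ * (N * Nᴴ) * E by simp only [Matrix.mul_assoc], hN,
      show Eᴴ * (E * diagonal (fun i => (d i : ℂ)) * Eᴴ) * E =
        (Eᴴ * E) * diagonal (fun i => (d i : ℂ)) * (Eᴴ * E) by simp only [Matrix.mul_assoc], hE2]
    simp
  have hWij : ∀ i j, ∑ l, W i l * (starRingEnd ℂ) (W j l) = if i = j then (d i : ℂ) else 0 := by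
    intro i j
    have := congrFun (congrFun hWW i) j
    rw [Matrix.mul_apply, Matrix.diagonal_apply] at this
    simpa [conjTranspose_apply] using this
  let v : Fin m → EuclideanSpace ℂ (Fin m) := fun j =>
    if h : j.1 < n then WithLp.toLp 2 (fun l => ((Real.sqrt (d ⟨j, h⟩))⁻¹ : ℂ) * W ⟨j, h⟩ l) else 0
  let s : Set (Fin m) := {j | ∃ h : j.1 < n, d ⟨j, h⟩ ≠ 0}
  have hv : Orthonormal ℂ (s.domRestrict v) := by
    rw [orthonormal_iff_ite]
    rintro ⟨i, hi, hi'⟩ ⟨j, hj, hj'⟩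
    have h1 := hWij ⟨j, hj⟩ ⟨i, hi⟩
    simp only [Set.domRestrict_apply, v, hi, hj, dif_pos, PiLp.inner_apply, RCLike.inner_apply,
      map_mul, map_inv₀, Complex.conj_ofReal]
    have : ∀ l, ((Real.sqrt (d ⟨j, hj⟩) : ℂ))⁻¹ * W ⟨j, hj⟩ l *
        (((Real.sqrt (d ⟨i, hi⟩) : ℂ))⁻¹ * (starRingEnd ℂ) (W ⟨i, hi⟩ l)) =
        ((Real.sqrt (d ⟨j, hj⟩) : ℂ))⁻¹ * ((Real.sqrt (d ⟨i, hi⟩) : ℂ))⁻¹ *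
        (W ⟨j, hj⟩ l * (starRingEnd ℂ) (W ⟨i, hi⟩ l)) := fun l => by ring
    simp only [this]
    rw [← Finset.mul_sum, h1]
    by_cases hij : i = j
    · subst hij
      simp only [if_true]
      have h2 : (Real.sqrt (d ⟨i, hi⟩) : ℂ) * (Real.sqrt (d ⟨i, hi⟩) : ℂ) = d ⟨i, hi⟩ := by
        rw [← Complex.ofReal_mul, Real.mul_self_sqrt (hd _)]
      have h3 : (Real.sqrt (d ⟨i, hi⟩) : ℂ) ≠ 0 := by
        intro h; rw [h] at h2; simp at h2; exact hi' (by exact_mod_cast h2.symm)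
      rw [← h2]
      field_simp
    · have : ¬ (j = i) := fun h => hij h.symm
      have h5 : ¬ (j.1 = i.1) := fun h => this (Fin.ext h)
      simp [hij, h5]
  obtain ⟨b, hb⟩ := hv.exists_orthonormalBasis_extension_of_card_eq (by simp)
  let V0 : Matrix (Fin n) (Fin m) ℂ := fun i l => b (Fin.castLE hnm i) l
  have hV0 : V0 * V0ᴴ = 1 := by
    ext i j
    have := orthonormal_iff_ite.1 b.orthonormal (Fin.castLE hnm j) (Fin.castLE hnm i)
    rw [PiLp.inner_apply] at this
    simp only [RCLike.inner_apply] at this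
    rw [Matrix.mul_apply]
    simp only [V0]
    rw [Matrix.one_apply]
    refine this.trans ?_
    by_cases hij : i = j
    · simp [hij]
    · have h1 : ¬ (j = i) := fun h => hij h.symm
      simp [hij, h1]
  have hWV : W = diagonal (fun i => (Real.sqrt (d i) : ℂ)) * V0 := by
    ext i l
    rw [Matrix.diagonal_mul]
    by_cases h0 : d i = 0
    · have h1 := hWij i i
      simp only [if_true, h0, Complex.mul_conj] at h1
      have h2 : ∑ l, Complex.normSq (W i l) = 0 := by exact_mod_cast h1
      have := (Finset.sum_eq_zero_iff_of_nonneg (fun l _ => Complex.normSq_nonneg _)).1 h2 l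
        (Finset.mem_univ _)
      simp [h0, Complex.normSq_eq_zero.1 this]
    · have h1 := hb (Fin.castLE hnm i) ⟨i.2, h0⟩
      have h3 : (Real.sqrt (d i) : ℂ) ≠ 0 := by
        have : Real.sqrt (d i) ≠ 0 := by
          rw [Real.sqrt_ne_zero (hd i)]; exact h0
        exact_mod_cast this
      simp only [V0, h1, v]
      simp [h3]
  refine ⟨E * diagonal (fun i => (Real.sqrt (d i) : ℂ)) * Eᴴ, E * V0, ?_, ?_, ?_⟩
  · apply PosSemidef.mul_mul_conjTranspose_same
    apply PosSemidef.diagonal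
    intro i
    simp [Real.sqrt_nonneg]
  · rw [conjTranspose_mul, show E * V0 * (V0ᴴ * Eᴴ) = E * (V0 * V0ᴴ) * Eᴴ by
      simp only [Matrix.mul_assoc], hV0, Matrix.mul_one, hE1]
  · rw [show E * diagonal (fun i => (Real.sqrt (d i) : ℂ)) * Eᴴ * (E * V0) =
      E * diagonal (fun i => (Real.sqrt (d i) : ℂ)) * (Eᴴ * E) * V0 by
      simp only [Matrix.mul_assoc], hE2, Matrix.mul_one, Matrix.mul_assoc, ← hWV, hW,
      ← Matrix.mul_assoc, hE1, Matrix.one_mul]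

lemma sqrt_form {n : ℕ} {A : Matrix (Fin n) (Fin n) ℂ} (hA : A.PosSemidef) :
    ∃ Q S : Matrix (Fin n) (Fin n) ℂ, Qᴴ = Q ∧ Sᴴ = S ∧ Q * Q = A ∧ Q * S = S * Q ∧
      Q * S * Q = Q := by
  obtain ⟨E, d, hE1, hE2, hd, hN⟩ := spec_form hA
  have key : ∀ X Y : Matrix (Fin n) (Fin n) ℂ, E * X * Eᴴ * (E * Y * Eᴴ) = E * (X * Y) * Eᴴ := by
    intro X Y
    rw [show E * X * Eᴴ * (E * Y * Eᴴ) = E * X * (Eᴴ * E) * Y * Eᴴ by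
      simp only [Matrix.mul_assoc], hE2, Matrix.mul_one]
    simp only [Matrix.mul_assoc]
  refine ⟨E * diagonal (fun i => (Real.sqrt (d i) : ℂ)) * Eᴴ,
    E * diagonal (fun i => ((Real.sqrt (d i) : ℂ))⁻¹) * Eᴴ, ?_, ?_, ?_, ?_, ?_⟩
  · simp only [conjTranspose_mul, conjTranspose_conjTranspose, Matrix.mul_assoc,
      diagonal_conjTranspose]
    congr 3
    ext i; simp
  · simp only [conjTranspose_mul, conjTranspose_conjTranspose, Matrix.mul_assoc,
      diagonal_conjTranspose]
    congr 3
    ext i; simp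
  · rw [key, hN, diagonal_mul_diagonal]
    congr 3
    ext i
    rw [← Complex.ofReal_mul, Real.mul_self_sqrt (hd i)]
  · rw [key, key, diagonal_mul_diagonal, diagonal_mul_diagonal]
    congr 3
    ext i
    ring
  · rw [key, key, diagonal_mul_diagonal, diagonal_mul_diagonal]
    congr 3
    ext i
    by_cases h : (Real.sqrt (d i) : ℂ) = 0
    · simp [h]
    · field_simp

lemma retr_self {a b : Type*} [Fintype a] [Fintype b] (M : Matrix a b ℂ) :
    (M * Mᴴ).trace.re = ∑ i, ∑ j, Complex.normSq (M i j) := by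
  simp [Matrix.trace, Matrix.mul_apply, Complex.mul_conj]

lemma retr_mul_le {a b c : Type} [Fintype a] [Fintype b] [Fintype c]
    (X : Matrix a b ℂ) (Y : Matrix b c ℂ) :
    ((X * Y) * (X * Y)ᴴ).trace.re ≤ (X * Xᴴ).trace.re * (Y * Yᴴ).trace.re := by
  let _ := @Matrix.frobeniusNormedAddCommGroup
  have key : ∀ {a b : Type} [Fintype a] [Fintype b] (M : Matrix a b ℂ),
    (M * Mᴴ).trace.re = ‖M‖ ^ 2 := by
    intro a b _ _ M
    rw [retr_self, frobenius_norm_def, ← Real.sqrt_eq_rpow, Real.sq_sqrt (by positivity)]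
    simp [Complex.normSq_eq_norm_sq]
  rw [key, key, key, ← mul_pow]
  gcongr
  exact frobenius_norm_mul X Y

/-- Cauchy-Schwarz for the Hilbert-Schmidt inner product. -/
lemma cs_sum {ι : Type*} [Fintype ι] (f g : ι → ℂ) :
    ‖∑ i, f i * (starRingEnd ℂ) (g i)‖ ^ 2 ≤
      (∑ i, Complex.normSq (f i)) * ∑ i, Complex.normSq (g i) := by
  calc ‖∑ i, f i * (starRingEnd ℂ) (g i)‖ ^ 2 ≤ (∑ i, ‖f i‖ * ‖g i‖) ^ 2 := by
        gcongr
        refine (norm_sum_le _ _).trans (le_of_eq ?_)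
        simp
    _ ≤ _ := by
        simp only [Complex.normSq_eq_norm_sq]
        exact Finset.sum_mul_sq_le_sq_mul_sq _ _ _

lemma psd_factor {d : Type*} [Fintype d] [DecidableEq d] {F : Matrix d d ℂ} (hF : F.PosSemidef) :
    ∃ K : Matrix d d ℂ, F = Kᴴ * K := by
  open scoped MatrixOrder in
  exact CStarAlgebra.nonneg_iff_eq_star_mul_self.1 hF.nonneg

lemma classical_core {n : ℕ} (r s t : Fin n → ℝ) (hr : ∀ i, 0 ≤ r i) (hs : ∀ i, 0 ≤ s i)
    (ht : ∀ i, 0 ≤ t i) (D p β : ℝ) (hD : 0 ≤ D) (hp : 0 < p) (hβ : 1 < β)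
    (h1 : p ≤ ∑ i, Real.sqrt (t i * r i)) (h2 : ∑ i, t i ≤ p)
    (h3 : ∀ B : Finset (Fin n), ∑ i ∈ B, s i ≠ 0 →
      (∑ i ∈ B, r i) * Real.logb 2 ((∑ i ∈ B, r i) / ∑ i ∈ B, s i) ≤ D)
    (h4 : ∀ i, s i = 0 → r i = 0) :
    p * (1 - (Real.sqrt β)⁻¹) ≤
      Real.sqrt ((2 : ℝ) ^ (β * D / p)) * ∑ i, Real.sqrt (t i * s i) := by
  classical
  set c : ℝ := (2 : ℝ) ^ (β * D / p) with hc
  have hcpos : 0 < c := by positivity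
  have hc1 : 1 ≤ c := Real.one_le_rpow (by norm_num) (by positivity)
  set B := Finset.univ.filter (fun i => c * s i < r i) with hB
  have hrB : ∑ i ∈ B, r i ≤ p / β := by
    by_cases hne : B.Nonempty
    · have hlt : c * ∑ i ∈ B, s i < ∑ i ∈ B, r i := by
        rw [Finset.mul_sum]
        exact Finset.sum_lt_sum_of_nonempty hne (fun i hi => (Finset.mem_filter.1 hi).2)
      have hs0 : ∑ i ∈ B, s i ≠ 0 := by
        intro h
        obtain ⟨i, hi⟩ := hne
        have h5 := (Finset.sum_eq_zero_iff_of_nonneg (fun i _ => hs i)).1 h i hi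
        have h6 := (Finset.mem_filter.1 hi).2
        rw [h5, h4 i h5] at h6
        simp at h6
      have hspos : 0 < ∑ i ∈ B, s i := lt_of_le_of_ne (Finset.sum_nonneg fun i _ => hs i) hs0.symm
      have h5 := h3 B hs0
      have hrpos : 0 < ∑ i ∈ B, r i := lt_of_le_of_lt (by positivity) hlt
      have h6 : β * D / p < Real.logb 2 ((∑ i ∈ B, r i) / ∑ i ∈ B, s i) := by
        rw [Real.lt_logb_iff_rpow_lt (by norm_num) (by positivity), lt_div_iff₀ hspos]
        exact hlt
      have h7 : (∑ i ∈ B, r i) * (β * D / p) < D := lt_of_lt_of_le (by gcongr) h5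
      have hDpos : 0 < D := lt_of_le_of_lt (by positivity) h7
      rw [le_div_iff₀ (by linarith)]
      have h8 : (∑ i ∈ B, r i) * (β * D / p) = ((∑ i ∈ B, r i) * β / p) * D := by ring
      rw [h8] at h7
      have h9 : (∑ i ∈ B, r i) * β / p < 1 := by
        by_contra h
        push Not at h
        nlinarith
      rw [div_lt_one hp] at h9
      exact h9.le
    · rw [Finset.not_nonempty_iff_eq_empty] at hne
      rw [hne]; simp; positivity
  have hbad : ∑ i ∈ B, Real.sqrt (t i * r i) ≤ p * (Real.sqrt β)⁻¹ := by
    have htB : ∑ i ∈ B, t i ≤ p :=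
      (Finset.sum_le_univ_sum_of_nonneg ht).trans h2
    have h5 : ∑ i ∈ B, Real.sqrt (t i * r i) = ∑ i ∈ B, Real.sqrt (t i) * Real.sqrt (r i) :=
      Finset.sum_congr rfl fun i _ => Real.sqrt_mul (ht i) _
    rw [h5]
    refine (Real.sum_sqrt_mul_sqrt_le _ ht hr).trans ?_
    rw [← Real.sqrt_mul (Finset.sum_nonneg fun i _ => ht i)]
    have : p * (Real.sqrt β)⁻¹ = Real.sqrt (p * (p / β)) := by
      rw [show p * (p / β) = p ^ 2 / β by ring, Real.sqrt_div (by positivity), Real.sqrt_sq hp.le]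
      rfl
    rw [this]
    apply Real.sqrt_le_sqrt
    gcongr
    exact Finset.sum_nonneg fun i _ => hr i
  have hgood : ∑ i ∈ Bᶜ, Real.sqrt (t i * r i) ≤ Real.sqrt c * ∑ i, Real.sqrt (t i * s i) := by
    rw [Finset.mul_sum]
    refine le_trans ?_ (Finset.sum_le_univ_sum_of_nonneg (s := Bᶜ) fun i => by positivity)
    apply Finset.sum_le_sum
    intro i hi
    rw [← Real.sqrt_mul hcpos.le]
    apply Real.sqrt_le_sqrt
    have h5 : r i ≤ c * s i := by
      simpa [hB] using hi
    nlinarith [mul_le_mul_of_nonneg_left h5 (ht i)]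
  have hsplit := Finset.sum_add_sum_compl B (fun i => Real.sqrt (t i * r i))
  linarith


lemma proj_fix {n m : ℕ} {σ Q S : Matrix (Fin n) (Fin n) ℂ} (A : Matrix (Fin n) (Fin m) ℂ)
    (hQ : Qᴴ = Q) (hS : Sᴴ = S) (hQQ : Q * Q = σ) (hQS : Q * S = S * Q) (hQSQ : Q * S * Q = Q)
    (hker : ∀ v : Fin n → ℂ, σ *ᵥ v = 0 → (A * Aᴴ) *ᵥ v = 0) : Q * S * A = A := by
  have h1 : σ * (1 - Q * S) = 0 := by
    rw [Matrix.mul_sub, Matrix.mul_one, sub_eq_zero, ← hQQ, hQS, Matrix.mul_assoc,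
      ← Matrix.mul_assoc Q S Q, hQSQ]
  have h2 : (A * Aᴴ) * (1 - Q * S) = 0 := by
    ext i j
    have h3 : σ *ᵥ ((1 - Q * S).col j) = 0 := by
      ext k
      have := congrFun (congrFun h1 k) j
      simpa [Matrix.mul_apply, Matrix.mulVec, dotProduct] using this
    have h4 := congrFun (hker _ h3) i
    simpa [Matrix.mul_apply, Matrix.mulVec, dotProduct] using h4
  have hP : (1 - Q * S)ᴴ = 1 - Q * S := by
    rw [conjTranspose_sub, conjTranspose_mul, hQ, hS, conjTranspose_one, hQS]
  have h5 : ((1 - Q * S) * A) * ((1 - Q * S) * A)ᴴ = 0 := by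
    rw [conjTranspose_mul, hP, show (1 - Q * S) * A * (Aᴴ * (1 - Q * S)) =
      (1 - Q * S) * (A * Aᴴ * (1 - Q * S)) by simp only [Matrix.mul_assoc], h2, Matrix.mul_zero]
  have h6 : (1 - Q * S) * A = 0 := Matrix.self_mul_conjTranspose_eq_zero.1 h5
  rw [Matrix.sub_mul, Matrix.one_mul, sub_eq_zero] at h6
  exact h6.symm

lemma dom_bound {n m : ℕ} {σ : Matrix (Fin n) (Fin n) ℂ} (hσ : σ.PosSemidef)
    (A : Matrix (Fin n) (Fin m) ℂ)
    (hker : ∀ v : Fin n → ℂ, σ *ᵥ v = 0 → (A * Aᴴ) *ᵥ v = 0) :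
    ∃ C : ℝ, 0 ≤ C ∧ ∀ F : Matrix (Fin n) (Fin n) ℂ, F.PosSemidef →
      0 ≤ trR F (A * Aᴴ) ∧ 0 ≤ trR F σ ∧ trR F (A * Aᴴ) ≤ C * trR F σ := by
  obtain ⟨Q, S, hQ, hS, hQQ, hQS, hQSQ⟩ := sqrt_form hσ
  have hA := proj_fix A hQ hS hQQ hQS hQSQ hker
  have hnn : ∀ {a b : Type} [Fintype a] [Fintype b] (M : Matrix a b ℂ),
      0 ≤ (M * Mᴴ).trace.re := by
    intro a b _ _ M
    rw [retr_self]
    exact Finset.sum_nonneg fun i _ => Finset.sum_nonneg fun j _ => Complex.normSq_nonneg _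
  refine ⟨((S * A) * (S * A)ᴴ).trace.re, hnn _, ?_⟩
  intro F hF
  obtain ⟨K, rfl⟩ := psd_factor hF
  have e1 : ∀ M : Matrix (Fin n) (Fin m) ℂ, trR (Kᴴ * K) (M * Mᴴ) = ((K * M) * (K * M)ᴴ).trace.re := by
    intro M
    unfold trR
    rw [Matrix.mul_assoc, Matrix.trace_mul_comm, conjTranspose_mul]
    simp only [Matrix.mul_assoc]
  have e2 : trR (Kᴴ * K) σ = ((K * Q) * (K * Q)ᴴ).trace.re := by
    unfold trR
    rw [Matrix.mul_assoc, Matrix.trace_mul_comm, conjTranspose_mul, hQ, ← hQQ]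
    simp only [Matrix.mul_assoc]
  rw [e1, e2]
  refine ⟨hnn _, hnn _, ?_⟩
  have e3 : K * A = (K * Q) * (S * A) := by
    conv_lhs => rw [← hA]
    simp only [Matrix.mul_assoc]
  rw [e3, mul_comm]
  exact retr_mul_le _ _

lemma qcore {n m : ℕ} (hnm : n ≤ m) {σ : Matrix (Fin n) (Fin n) ℂ} (hσ : σ.PosSemidef)
    (A T : Matrix (Fin n) (Fin m) ℂ)
    (hker : ∀ v : Fin n → ℂ, σ *ᵥ v = 0 → (A * Aᴴ) *ᵥ v = 0) :
    ∃ (B : Matrix (Fin n) (Fin m) ℂ) (E : Matrix (Fin n) (Fin n) ℂ) (t : Fin n → ℝ),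
      B * Bᴴ = σ ∧ E * Eᴴ = 1 ∧ Eᴴ * E = 1 ∧ (∀ i, 0 ≤ t i) ∧
      (T * Aᴴ).trace.re ≤ ∑ i, Real.sqrt (t i * ((Eᴴ * (A * Aᴴ) * E) i i).re) ∧
      ∑ i, t i ≤ (T * Tᴴ).trace.re ∧
      (T * Bᴴ).trace.re = ∑ i, Real.sqrt (t i * ((Eᴴ * σ * E) i i).re) := by
  obtain ⟨Q, S, hQ, hS, hQQ, hQS, hQSQ⟩ := sqrt_form hσ
  have hA := proj_fix A hQ hS hQQ hQS hQSQ hker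
  obtain ⟨H, V, hH, hV, hN⟩ := polar hnm (Q * T)
  have hHN : H = Q * T * Vᴴ := by rw [hN, Matrix.mul_assoc, hV, Matrix.mul_one]
  have hPH : Q * S * H = H := by
    rw [hHN, ← Matrix.mul_assoc, ← Matrix.mul_assoc, hQSQ]
  have hHh : Hᴴ = H := hH.1
  have hHP : H * (Q * S) = H := by
    have := congrArg conjTranspose hPH
    rw [conjTranspose_mul, conjTranspose_mul, hHh, hQ, hS, ← hQS] at this
    exact this
  have hHH : H * H = Q * T * Tᴴ * Q := by
    calc H * H = H * (V * Vᴴ) * Hᴴ := by rw [hV, Matrix.mul_one, hHh]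
      _ = (H * V) * (H * V)ᴴ := by rw [conjTranspose_mul]; simp only [Matrix.mul_assoc]
      _ = _ := by rw [← hN, conjTranspose_mul, hQ]; simp only [Matrix.mul_assoc]
  have hX : (S * H * S).PosSemidef := by
    have := hH.mul_mul_conjTranspose_same S
    rwa [hS] at this
  obtain ⟨E, x, hE1, hE2, hx, hXE⟩ := spec_form hX
  set T' := Q * S * T with hT'
  have hXsX : (S * H * S) * σ * (S * H * S) = T' * T'ᴴ := by
    calc (S * H * S) * σ * (S * H * S) = S * (H * (S * Q)) * ((Q * S) * H) * S := by
          rw [← hQQ]; simp only [Matrix.mul_assoc]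
      _ = S * (H * H) * S := by rw [← hQS, hHP, hPH]; simp only [Matrix.mul_assoc]
      _ = _ := by
        rw [hHH, hT', conjTranspose_mul, conjTranspose_mul, hQ, hS]
        rw [show S * (Q * T * Tᴴ * Q) * S = (S * Q) * T * Tᴴ * (Q * S) by
          simp only [Matrix.mul_assoc], ← hQS]
        rw [hQS]
        simp only [Matrix.mul_assoc]
  have hXs : ((S * H * S) * σ).trace = H.trace := by
    calc ((S * H * S) * σ).trace = (S * (H * (S * Q)) * Q).trace := by
          rw [← hQQ]; simp only [Matrix.mul_assoc]
      _ = (S * H * Q).trace := by rw [← hQS, hHP]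
      _ = ((Q * S) * H).trace := by rw [Matrix.trace_mul_comm]; simp only [Matrix.mul_assoc]
      _ = _ := by rw [hPH]
  have hTA : (T' * Aᴴ).trace = (T * Aᴴ).trace := by
    have h1 : Aᴴ * (Q * S) = Aᴴ := by
      have := congrArg conjTranspose hA
      rw [conjTranspose_mul, conjTranspose_mul, hQ, hS, ← hQS] at this
      exact this
    rw [hT', Matrix.mul_assoc, Matrix.trace_mul_comm, Matrix.mul_assoc, h1]
  have hTT : (T' * T'ᴴ).trace.re ≤ (T * Tᴴ).trace.re := by
    have h1 : 0 ≤ ((T - T') * (T - T')ᴴ).trace.re := by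
      rw [retr_self]
      exact Finset.sum_nonneg fun i _ => Finset.sum_nonneg fun j _ => Complex.normSq_nonneg _
    have hPh : (Q * S)ᴴ = Q * S := by rw [conjTranspose_mul, hQ, hS, hQS]
    have hPP : (Q * S) * (Q * S) = Q * S := by rw [← Matrix.mul_assoc, hQSQ]
    have h2 : (T * T'ᴴ).trace = (T' * T'ᴴ).trace := by
      rw [hT', conjTranspose_mul, hPh]
      rw [← Matrix.mul_assoc, Matrix.trace_mul_comm, ← Matrix.mul_assoc,
        ← Matrix.mul_assoc (Q * S * T), Matrix.trace_mul_comm (Q * S * T * Tᴴ),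
        ← Matrix.mul_assoc, ← Matrix.mul_assoc, hPP]
    have h3 : (T' * Tᴴ).trace = (T' * T'ᴴ).trace := by
      rw [hT', conjTranspose_mul, hPh, ← Matrix.mul_assoc (Q * S * T),
        Matrix.trace_mul_comm (Q * S * T * Tᴴ),
        ← Matrix.mul_assoc, ← Matrix.mul_assoc, hPP]
    rw [conjTranspose_sub, Matrix.sub_mul, Matrix.mul_sub, Matrix.mul_sub, trace_sub, trace_sub,
      trace_sub, h2, h3] at h1
    simpa using h1
  have conjt : ∀ M : Matrix (Fin n) (Fin n) ℂ, M.trace = (Eᴴ * M * E).trace := by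
    intro M
    rw [Matrix.trace_mul_comm, ← Matrix.mul_assoc, hE1, Matrix.one_mul]
  have diagf : ∀ M : Matrix (Fin n) (Fin m) ℂ, ∀ i,
      ((Eᴴ * (M * Mᴴ) * E) i i).re = ∑ l, Complex.normSq ((Eᴴ * M) i l) := by
    intro M i
    have : Eᴴ * (M * Mᴴ) * E = (Eᴴ * M) * (Eᴴ * M)ᴴ := by
      rw [conjTranspose_mul, conjTranspose_conjTranspose]; simp only [Matrix.mul_assoc]
    rw [this, Matrix.mul_apply, Complex.re_sum]
    refine Finset.sum_congr rfl fun l _ => ?_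
    rw [conjTranspose_apply]
    simp [Complex.normSq_apply]
  have hEX : Eᴴ * (S * H * S) = diagonal (fun i => (x i : ℂ)) * Eᴴ := by
    rw [hXE, ← Matrix.mul_assoc, ← Matrix.mul_assoc, hE2, Matrix.one_mul]
  have hXE' : (S * H * S) * E = E * diagonal (fun i => (x i : ℂ)) := by
    rw [hXE, Matrix.mul_assoc, hE2, Matrix.mul_one]
  have hs : ∀ i, 0 ≤ ((Eᴴ * σ * E) i i).re := by
    intro i
    have := (hσ.conjTranspose_mul_mul_same E).diag_nonneg (i := i)
    exact (Complex.le_def.1 this).1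
  have ht : ∀ i, ((Eᴴ * (T' * T'ᴴ) * E) i i).re = x i * x i * ((Eᴴ * σ * E) i i).re := by
    intro i
    have : Eᴴ * (T' * T'ᴴ) * E =
        diagonal (fun i => (x i : ℂ)) * (Eᴴ * σ * E) * diagonal (fun i => (x i : ℂ)) := by
      rw [← hXsX]
      calc Eᴴ * ((S * H * S) * σ * (S * H * S)) * E
          = (Eᴴ * (S * H * S)) * σ * ((S * H * S) * E) := by simp only [Matrix.mul_assoc]
        _ = _ := by rw [hEX, hXE']; simp only [Matrix.mul_assoc]
    rw [this, Matrix.mul_diagonal, Matrix.diagonal_mul]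
    simp
    ring
  refine ⟨Q * V, E, fun i => ((Eᴴ * (T' * T'ᴴ) * E) i i).re, ?_, hE1, hE2, ?_, ?_, ?_, ?_⟩
  · rw [conjTranspose_mul, hQ, show Q * V * (Vᴴ * Q) = Q * (V * Vᴴ) * Q by
      simp only [Matrix.mul_assoc], hV, Matrix.mul_one, hQQ]
  · intro i
    simp only [diagf]
    exact Finset.sum_nonneg fun l _ => Complex.normSq_nonneg _
  · rw [← hTA, conjt, Matrix.trace, Complex.re_sum]
    apply Finset.sum_le_sum
    intro i _
    simp only [diagf]
    apply Real.le_sqrt_of_sq_le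
    refine le_trans ?_ (cs_sum _ _)
    have : Eᴴ * (T' * Aᴴ) * E = (Eᴴ * T') * (Eᴴ * A)ᴴ := by
      rw [conjTranspose_mul, conjTranspose_conjTranspose]; simp only [Matrix.mul_assoc]
    rw [this, diag_apply, Matrix.mul_apply, ← sq_abs]
    gcongr
    exact Complex.abs_re_le_norm _
  · rw [← Complex.re_sum]
    exact le_trans (le_of_eq (congrArg Complex.re (conjt (T' * T'ᴴ)).symm)) hTT
  · have h1 : (T * (Q * V)ᴴ).trace = H.trace := by
      rw [conjTranspose_mul, hQ, ← Matrix.mul_assoc, Matrix.trace_mul_comm, ← Matrix.mul_assoc, ← hHN]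
    rw [h1, ← hXs, conjt, Matrix.trace, Complex.re_sum]
    refine Finset.sum_congr rfl fun i _ => ?_
    simp only [ht]
    rw [show x i * x i * ((Eᴴ * σ * E) i i).re * ((Eᴴ * σ * E) i i).re =
      (x i * ((Eᴴ * σ * E) i i).re) ^ 2 by ring, Real.sqrt_sq (mul_nonneg (hx i) (hs i)),
      ← Matrix.mul_assoc, hEX, diag_apply, Matrix.mul_assoc, Matrix.mul_assoc, Matrix.diagonal_mul,
      ← Matrix.mul_assoc]
    simp

lemma povm_sub {n : ℕ} {E : Matrix (Fin n) (Fin n) ℂ} (hE1 : E * Eᴴ = 1)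
    (B : Finset (Fin n)) : ∃ F : Matrix (Fin n) (Fin n) ℂ, IsPOVMElem F ∧
      ∀ M, trR F M = ∑ i ∈ B, ((Eᴴ * M * E) i i).re := by
  classical
  refine ⟨E * diagonal (fun i => if i ∈ B then (1 : ℂ) else 0) * Eᴴ, ⟨?_, ?_⟩, ?_⟩
  · apply PosSemidef.mul_mul_conjTranspose_same
    apply PosSemidef.diagonal
    intro i
    simp only [Pi.zero_apply]
    split_ifs <;> simp
  · have : (1 : Matrix (Fin n) (Fin n) ℂ) - E * diagonal (fun i => if i ∈ B then (1 : ℂ) else 0) * Eᴴ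
        = E * diagonal (fun i => if i ∈ B then (0 : ℂ) else 1) * Eᴴ := by
      have h1 : diagonal (fun i => if i ∈ B then (0 : ℂ) else 1) =
          1 - diagonal (fun i => if i ∈ B then (1 : ℂ) else 0) := by
        rw [← diagonal_one, diagonal_sub]
        congr 1
        ext i
        split_ifs <;> simp
      rw [h1, Matrix.mul_sub, Matrix.sub_mul, Matrix.mul_one, hE1]
    rw [this]
    apply PosSemidef.mul_mul_conjTranspose_same
    apply PosSemidef.diagonal
    intro i
    simp only [Pi.zero_apply]
    split_ifs <;> simp
  · intro M
    unfold trR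
    rw [show E * diagonal (fun i => if i ∈ B then (1 : ℂ) else 0) * Eᴴ * M =
      E * (diagonal (fun i => if i ∈ B then (1 : ℂ) else 0) * (Eᴴ * M)) by
      simp only [Matrix.mul_assoc], Matrix.trace_mul_comm, Matrix.mul_assoc, Matrix.trace,
      Complex.re_sum]
    simp only [diag_apply, Matrix.diagonal_mul]
    rw [← Finset.sum_filter_add_sum_filter_not Finset.univ (fun i => i ∈ B)]
    rw [Finset.sum_eq_zero (s := Finset.univ.filter (fun i => i ∉ B))]
    · rw [add_zero, Finset.filter_mem_eq_inter, Finset.univ_inter]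
      refine Finset.sum_congr rfl fun i hi => ?_
      simp [hi]
    · intro i hi
      simp [(Finset.mem_filter.1 hi).2]

lemma obs_facts {n m : ℕ} {σ : Matrix (Fin n) (Fin n) ℂ} (hσ : σ.PosSemidef)
    (hσ1 : σ.trace = 1) (A : Matrix (Fin n) (Fin m) ℂ) (hA1 : (A * Aᴴ).trace = 1)
    (hker : ∀ v : Fin n → ℂ, σ *ᵥ v = 0 → (A * Aᴴ) *ᵥ v = 0) :
    0 ≤ obsDiv (A * Aᴴ) σ ∧ ∀ F, IsPOVMElem F → trR F σ ≠ 0 →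
      trR F (A * Aᴴ) * Real.logb 2 (trR F (A * Aᴴ) / trR F σ) ≤ obsDiv (A * Aᴴ) σ := by
  obtain ⟨C, hC, hb⟩ := dom_bound hσ A hker
  have hbdd : BddAbove {x : ℝ | ∃ F : Matrix (Fin n) (Fin n) ℂ, IsPOVMElem F ∧ trR F σ ≠ 0 ∧
    x = trR F (A * Aᴴ) * Real.logb 2 (trR F (A * Aᴴ) / trR F σ)} := by
    refine ⟨max 0 (Real.logb 2 (max C 1)), ?_⟩
    rintro y ⟨F, hF, hne, rfl⟩
    obtain ⟨h1, h2, h3⟩ := hb F hF.1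
    have hle : trR F (A * Aᴴ) ≤ 1 := by
      have h4 := (hb _ hF.2).1
      unfold trR at h4 ⊢
      rw [Matrix.sub_mul, trace_sub, Matrix.one_mul, hA1] at h4
      simp only [Complex.sub_re, Complex.one_re] at h4
      linarith
    have hpos : 0 < trR F σ := lt_of_le_of_ne h2 hne.symm
    rcases h1.eq_or_lt with h0 | h0
    · rw [← h0]; simp
    · have h5 : Real.logb 2 (trR F (A * Aᴴ) / trR F σ) ≤ max 0 (Real.logb 2 (max C 1)) := by
        refine le_trans ?_ (le_max_right _ _)
        apply Real.logb_le_logb_of_le (by norm_num) (by positivity)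
        rw [div_le_iff₀ hpos]
        exact h3.trans (by gcongr; exact le_max_left _ _)
      calc trR F (A * Aᴴ) * Real.logb 2 (trR F (A * Aᴴ) / trR F σ)
          ≤ trR F (A * Aᴴ) * max 0 (Real.logb 2 (max C 1)) := by gcongr
        _ ≤ 1 * max 0 (Real.logb 2 (max C 1)) := by
          gcongr
        _ = _ := one_mul _
  have hall : ∀ F, IsPOVMElem F → trR F σ ≠ 0 →
      trR F (A * Aᴴ) * Real.logb 2 (trR F (A * Aᴴ) / trR F σ) ≤ obsDiv (A * Aᴴ) σ :=
    fun F hF hne => le_csSup hbdd ⟨F, hF, hne, rfl⟩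
  refine ⟨?_, hall⟩
  have h1 : IsPOVMElem (1 : Matrix (Fin n) (Fin n) ℂ) := by
    refine ⟨PosSemidef.one, ?_⟩
    rw [sub_self]; exact PosSemidef.zero
  have := hall 1 h1 (by simp [trR, hσ1])
  simpa [trR, hσ1, hA1] using this

lemma trR_ketbra {d : Type*} [Fintype d] [DecidableEq d] (F K : Matrix d d ℂ) (hFK : F = Kᴴ * K)
    (φ : d → ℂ) : trR F (ketbra φ) = ∑ i, Complex.normSq ((K *ᵥ φ) i) := by
  have h1 : ketbra φ = vecMulVec φ (star φ) := by
    ext a b; simp [ketbra, vecMulVec_apply]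
  unfold trR
  rw [h1, hFK, Matrix.mul_vecMulVec, trace_vecMulVec, ← mulVec_mulVec, dotProduct_comm,
    dotProduct_mulVec, ← star_mulVec, dotProduct, Complex.re_sum]
  refine Finset.sum_congr rfl fun i _ => ?_
  simp [Complex.normSq_apply]

lemma cs_F {d : Type*} [Fintype d] [DecidableEq d] (F : Matrix d d ℂ) (hF : F.PosSemidef)
    (φ ψ : d → ℂ) : (∑ i, (F *ᵥ ψ) i * (starRingEnd ℂ) (φ i)).re ^ 2 ≤
      trR F (ketbra φ) * trR F (ketbra ψ) ∧
      (∑ i, (F *ᵥ ψ) i * (starRingEnd ℂ) (ψ i)).re = trR F (ketbra ψ) := by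
  obtain ⟨K, hK⟩ := psd_factor hF
  have h : ∀ φ, ∑ i, (F *ᵥ ψ) i * (starRingEnd ℂ) (φ i) =
      ∑ i, (K *ᵥ ψ) i * (starRingEnd ℂ) ((K *ᵥ φ) i) := by
    intro φ
    have : (F *ᵥ ψ) ⬝ᵥ star φ = (K *ᵥ ψ) ⬝ᵥ star (K *ᵥ φ) := by
      rw [hK, ← mulVec_mulVec, dotProduct_comm, dotProduct_mulVec, ← star_mulVec, dotProduct_comm]
    exact this
  rw [h, h, trR_ketbra F K hK, trR_ketbra F K hK, mul_comm]
  constructor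
  · refine le_trans ?_ (cs_sum _ _)
    rw [← sq_abs]
    gcongr
    exact Complex.abs_re_le_norm _
  · rw [Complex.re_sum]
    refine Finset.sum_congr rfl fun i _ => ?_
    simp [Complex.normSq_apply]

lemma trR_one_ketbra {d : Type*} [Fintype d] [DecidableEq d] (φ : d → ℂ) :
    trR 1 (ketbra φ) = ∑ i, Complex.normSq (φ i) := by
  simpa using trR_ketbra (1 : Matrix d d ℂ) 1 (by simp) φ

lemma povm_le {d : Type*} [Fintype d] [DecidableEq d] (F : Matrix d d ℂ) (hF : IsPOVMElem F)
    (φ : d → ℂ) : trR F (ketbra φ) ≤ ∑ i, Complex.normSq (φ i) := by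
  obtain ⟨K, hK⟩ := psd_factor hF.2
  have h1 : 0 ≤ trR (1 - F) (ketbra φ) := by
    rw [trR_ketbra _ K hK]
    exact Finset.sum_nonneg fun i _ => Complex.normSq_nonneg _
  rw [← trR_one_ketbra]
  unfold trR at h1 ⊢
  rw [Matrix.sub_mul, trace_sub, Complex.sub_re] at h1
  linarith

lemma final_num (p β D y z : ℝ) (hp : 0 < p) (hp1 : p ≤ 1) (hβ : 1 < β)
    (h : p * (1 - (Real.sqrt β)⁻¹) ≤ Real.sqrt ((2 : ℝ) ^ (β * D / p)) * y)
    (hz : y ^ 2 ≤ z * p) :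
    p / (2 : ℝ) ^ ((β * D - 2 * Real.logb 2 (1 - β ^ (-(1 : ℝ) / 2))) / p) ≤ z := by
  have hb : β ^ (-(1 : ℝ) / 2) = (Real.sqrt β)⁻¹ := by
    rw [Real.sqrt_eq_rpow, ← Real.rpow_neg (by linarith)]
    norm_num
  rw [hb]
  have hs1 : 1 < Real.sqrt β := by
    rw [Real.lt_sqrt (by norm_num)]; simpa using hβ
  set g := 1 - (Real.sqrt β)⁻¹ with hg
  have hg0 : 0 < g := by
    have := inv_lt_one_of_one_lt₀ hs1
    linarith
  have hg1 : g ≤ 1 := by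
    have : 0 ≤ (Real.sqrt β)⁻¹ := by positivity
    linarith
  set c := (2 : ℝ) ^ (β * D / p) with hc
  have hcpos : 0 < c := by positivity
  have h1 : (2 : ℝ) ^ ((β * D - 2 * Real.logb 2 g) / p) = c / g ^ (2 / p) := by
    rw [show (β * D - 2 * Real.logb 2 g) / p = β * D / p - Real.logb 2 g * (2 / p) by ring,
      Real.rpow_sub (by norm_num), Real.rpow_mul (by norm_num),
      Real.rpow_logb (by norm_num) (by norm_num) hg0]
  rw [h1]
  have h2 : g ^ (2 / p) ≤ g ^ 2 := by
    rw [← Real.rpow_natCast g 2]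
    apply Real.rpow_le_rpow_of_exponent_ge hg0 hg1
    rw [le_div_iff₀ hp]
    push_cast
    linarith
  have h3 : (p * g) ^ 2 ≤ c * y ^ 2 := by
    calc (p * g) ^ 2 ≤ (Real.sqrt c * y) ^ 2 := by gcongr
      _ = c * y ^ 2 := by rw [mul_pow, Real.sq_sqrt hcpos.le]
  have h4 : p * g ^ 2 ≤ c * z := by
    have : p * (p * g ^ 2) ≤ p * (c * z) := by
      calc p * (p * g ^ 2) = (p * g) ^ 2 := by ring
        _ ≤ c * y ^ 2 := h3
        _ ≤ c * (z * p) := by gcongr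
        _ = _ := by ring
    exact le_of_mul_le_mul_left this hp
  rw [div_div_eq_mul_div, div_le_iff₀ hcpos]
  calc p * g ^ (2 / p) ≤ p * g ^ 2 := by gcongr
    _ ≤ _ := by linarith

end helpers

/-- Observational substate lemma for a fixed measurement. -/
theorem observational_substate_fixed_measurement {n m : ℕ} (hnm : n ≤ m)
    (ρ σ : Matrix (Fin n) (Fin n) ℂ) (hρ : IsState ρ) (hσ : IsState σ)
    (hsupp : SuppLE ρ σ)
    (ψ : Fin n × Fin m → ℂ) (hψunit : ∑ p, Complex.normSq (ψ p) = 1)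
    (hψpur : ∀ i j : Fin n, ∑ l : Fin m, ψ (i, l) * (starRingEnd ℂ) (ψ (j, l)) = ρ i j)
    (F : Matrix (Fin n × Fin m) (Fin n × Fin m) ℂ) (hF : IsPOVMElem F)
    (β : ℝ) (hβ : 1 < β)
    (p : ℝ) (hp : p = trR F (ketbra ψ)) (hppos : 0 < p)
    (k' : ℝ)
    (hk' : k' = β * obsDiv ρ σ - 2 * Real.logb 2 (1 - β ^ (-(1 : ℝ) / 2))) :
    ∃ φ : Fin n × Fin m → ℂ, (∑ q, Complex.normSq (φ q) = 1) ∧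
      (∀ i j : Fin n, ∑ l : Fin m, φ (i, l) * (starRingEnd ℂ) (φ (j, l)) = σ i j) ∧
      trR F (ketbra φ) ≥ p / (2 : ℝ) ^ (k' / p) := by
  let A : Matrix (Fin n) (Fin m) ℂ := fun i l => ψ (i, l)
  have hA : A * Aᴴ = ρ := by
    ext i j
    rw [Matrix.mul_apply, ← hψpur]
    rfl
  subst hA
  let θ := F *ᵥ ψ
  let T : Matrix (Fin n) (Fin m) ℂ := fun i l => θ (i, l)
  have htr : ∀ (M N : Matrix (Fin n) (Fin m) ℂ),
      (M * Nᴴ).trace = ∑ q : Fin n × Fin m, M q.1 q.2 * (starRingEnd ℂ) (N q.1 q.2) := by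
    intro M N
    rw [Fintype.sum_prod_type]
    simp [Matrix.trace, Matrix.mul_apply]
  obtain ⟨hD0, hD⟩ := obs_facts hσ.1 hσ.2 A hρ.2 hsupp
  obtain ⟨C, hC, hdom⟩ := dom_bound hσ.1 A hsupp
  obtain ⟨B, E, t, hB, hE1, hE2, ht, h1, h2, h3⟩ := qcore hnm hσ.1 A T hsupp
  have hTA : (T * Aᴴ).trace.re = p := by
    rw [hp, ← (cs_F F hF.1 ψ ψ).2]
    exact congrArg Complex.re (htr T A)
  have hp1 : p ≤ 1 := by
    rw [hp, ← hψunit]; exact povm_le F hF ψ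
  have hTT : (T * Tᴴ).trace.re ≤ p := by
    have e1 : (T * Tᴴ).trace.re = ∑ q, Complex.normSq (θ q) := by
      rw [htr T T, Complex.re_sum]
      refine Finset.sum_congr rfl fun i _ => ?_
      change (θ i * (starRingEnd ℂ) (θ i)).re = _
      simp [Complex.normSq_apply]
    have e2 := (cs_F F hF.1 θ ψ).1
    have e3 : (∑ i, (F *ᵥ ψ) i * (starRingEnd ℂ) (θ i)).re = (T * Tᴴ).trace.re :=
      congrArg Complex.re (htr T T).symm
    rw [e3, ← hp] at e2
    have e4 := povm_le F hF θ
    rw [← e1] at e4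
    by_contra hlt
    push Not at hlt
    nlinarith [mul_le_mul_of_nonneg_right e4 hppos.le]
  have hpov := fun S => povm_sub hE1 S
  have hrs : ∀ i, 0 ≤ ((Eᴴ * (A * Aᴴ) * E) i i).re ∧ 0 ≤ ((Eᴴ * σ * E) i i).re ∧
      ((Eᴴ * (A * Aᴴ) * E) i i).re ≤ C * ((Eᴴ * σ * E) i i).re := by
    intro i
    obtain ⟨G, hG, hGM⟩ := hpov {i}
    have := hdom G hG.1
    simpa [hGM] using this
  have hcl := classical_core (fun i => ((Eᴴ * (A * Aᴴ) * E) i i).re) (fun i => ((Eᴴ * σ * E) i i).re) t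
    (fun i => (hrs i).1) (fun i => (hrs i).2.1) ht (obsDiv (A * Aᴴ) σ) p β hD0 hppos hβ
    (hTA ▸ h1) (h2.trans hTT)
    (by
      intro S hS
      obtain ⟨G, hG, hGM⟩ := hpov S
      have := hD G hG (by rw [hGM]; exact hS)
      rwa [hGM, hGM] at this)
    (by
      intro i hi
      have hi' : ((Eᴴ * σ * E) i i).re = 0 := hi
      have := hrs i
      rw [hi'] at this
      simp only [mul_zero] at this
      exact le_antisymm this.2.2 this.1)
  rw [← h3] at hcl
  refine ⟨fun q => B q.1 q.2, ?_, ?_, ?_⟩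
  · rw [Fintype.sum_prod_type]
    have := retr_self B
    rw [hB, hσ.2] at this
    simpa using this.symm
  · intro i j
    have := congrFun (congrFun hB i) j
    rw [Matrix.mul_apply] at this
    exact this
  · rw [hk']
    refine final_num p β _ _ _ hppos hp1 hβ hcl ?_
    have e2 := (cs_F F hF.1 (fun q => B q.1 q.2) ψ).1
    rw [← hp] at e2
    have e3 : (T * Bᴴ).trace.re =
        (∑ i, (F *ᵥ ψ) i * (starRingEnd ℂ) ((fun q : Fin n × Fin m => B q.1 q.2) i)).re :=
      congrArg Complex.re (htr T B)
    rw [e3]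
    exact e2

end
end

section
/- Observational divergence lifting: Let m ≥ n, let ρ and σ be quantum states on ℂ^n with supp(ρ) ⊆ supp(σ), and let ψ be a purification of ρ in ℂ^n ⊗ ℂ^m. Then there exists an extension ω of σ in ℂ^n ⊗ ℂ^m such that D(|ψ⟩⟨ψ| ‖ ω) < D(ρ‖σ) + 4·√(D(ρ‖σ)+1) + 2·logb 2 (D(ρ‖σ)+1) + 4; in particular, for every POVM element F on ℂ^n ⊗ ℂ^m with Tr(F·ω) ≠ 0, Tr(F·|ψ⟩⟨ψ|)·logb 2 (Tr(F·|ψ⟩⟨ψ|)/Tr(F·ω)) < D(ρ‖σ) + 4·√(D(ρ‖σ)+1) + 2·logb 2 (D(ρ‖σ)+1) + 4. -/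
open Matrix BigOperators
open scoped ComplexOrder

noncomputable section

lemma odl_trR_add_left {d : Type*} [Fintype d] (A B C : Matrix d d ℂ) :
    trR (A + B) C = trR A C + trR B C := by
  simp [trR, add_mul]

lemma odl_trR_sub_left {d : Type*} [Fintype d] (A B C : Matrix d d ℂ) :
    trR (A - B) C = trR A C - trR B C := by
  simp [trR, sub_mul]

lemma odl_trR_smul_left {d : Type*} [Fintype d] (c : ℝ) (A C : Matrix d d ℂ) :
    trR (c • A) C = c * trR A C := by
  simp [trR]

lemma odl_trR_comm {d : Type*} [Fintype d] (A B : Matrix d d ℂ) :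
    trR A B = trR B A := by
  simp [trR, Matrix.trace_mul_comm A B]

lemma odl_trR_add_right {d : Type*} [Fintype d] (A B C : Matrix d d ℂ) :
    trR C (A + B) = trR C A + trR C B := by
  simp [trR, mul_add]

lemma odl_trR_sub_right {d : Type*} [Fintype d] (A B C : Matrix d d ℂ) :
    trR C (A - B) = trR C A - trR C B := by
  simp [trR, mul_sub]

lemma odl_trR_smul_right {d : Type*} [Fintype d] (c : ℝ) (A C : Matrix d d ℂ) :
    trR C (c • A) = c * trR C A := by
  simp [trR]

lemma odl_trR_sum_right {d : Type*} [Fintype d] {ι : Type*} (s : Finset ι)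
    (A : ι → Matrix d d ℂ) (C : Matrix d d ℂ) :
    trR C (∑ k ∈ s, A k) = ∑ k ∈ s, trR C (A k) := by
  simp [trR, Finset.mul_sum, Matrix.trace_sum]

lemma odl_trR_nonneg {d : Type*} [Fintype d] [DecidableEq d] {A B : Matrix d d ℂ}
    (hA : A.PosSemidef) (hB : B.PosSemidef) : 0 ≤ trR A B := by
  obtain ⟨C, rfl⟩ : ∃ C : Matrix d d ℂ, B = Cᴴ * C := by
    open scoped MatrixOrder in
    have := (CStarAlgebra.nonneg_iff_eq_star_mul_self (a := B)).1 hB.nonneg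
    simpa [Matrix.star_eq_conjTranspose] using this
  have h1 := (hA.mul_mul_conjTranspose_same C).trace_nonneg
  have h2 : (A * (Cᴴ * C)).trace = (C * A * Cᴴ).trace := by
    rw [← mul_assoc, Matrix.trace_mul_comm, ← mul_assoc]
  rw [trR, h2]
  exact (Complex.le_def.1 h1).1

lemma odl_trR_mono_left {d : Type*} [Fintype d] [DecidableEq d] {A A' B : Matrix d d ℂ}
    (hA : (A' - A).PosSemidef) (hB : B.PosSemidef) : trR A B ≤ trR A' B := by
  have := odl_trR_nonneg hA hB
  rw [odl_trR_sub_left] at this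
  linarith

lemma odl_trR_mono_right {d : Type*} [Fintype d] [DecidableEq d] {A A' B : Matrix d d ℂ}
    (hB : B.PosSemidef) (hA : (A' - A).PosSemidef) : trR B A ≤ trR B A' := by
  rw [odl_trR_comm B, odl_trR_comm B]; exact odl_trR_mono_left hA hB

lemma odl_trR_ketbra {d : Type*} [Fintype d] (F : Matrix d d ℂ) (v : d → ℂ) :
    trR F (ketbra v) = (star v ⬝ᵥ (F *ᵥ v)).re := by
  have : (F * ketbra v).trace = star v ⬝ᵥ (F *ᵥ v) := by
    simp only [Matrix.trace, Matrix.diag, Matrix.mul_apply, ketbra, Matrix.of_apply, dotProduct,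
      mulVec, Finset.mul_sum, Pi.star_apply, RCLike.star_def]
    refine Finset.sum_congr rfl fun i _ => Finset.sum_congr rfl fun j _ => ?_
    ring
  rw [trR, this]

lemma odl_ketbra_psd {d : Type*} [Fintype d] (v : d → ℂ) : (ketbra v).PosSemidef := by
  have := Matrix.posSemidef_vecMulVec_self_star v
  exact this

lemma odl_trR_one {d : Type*} [Fintype d] [DecidableEq d] {ρ : Matrix d d ℂ} (h : IsState ρ) :
    trR 1 ρ = 1 := by
  simp [trR, h.2]

/-- Quadratic-form criterion for Hermitian matrices. -/
lemma odl_psd_of_re {d : Type*} [Fintype d] {A : Matrix d d ℂ} (hA : A.IsHermitian)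
    (h : ∀ v : d → ℂ, 0 ≤ trR A (ketbra v)) : A.PosSemidef := by
  refine Matrix.PosSemidef.of_dotProduct_mulVec_nonneg hA fun x => ?_
  have h1 := h x
  rw [odl_trR_ketbra] at h1
  refine Complex.le_def.2 ⟨h1, ?_⟩
  have := hA.im_star_dotProduct_mulVec_self x
  exact this.symm

/-- Partial trace over the second factor. -/
def odlPT {n m : ℕ} (ω : Matrix (Fin n × Fin m) (Fin n × Fin m) ℂ) : Matrix (Fin n) (Fin n) ℂ :=
  Matrix.of fun i j => ∑ l : Fin m, ω (i, l) (j, l)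

open scoped Kronecker in
lemma odl_trR_kron {n m : ℕ} (Y : Matrix (Fin n) (Fin n) ℂ)
    (ω : Matrix (Fin n × Fin m) (Fin n × Fin m) ℂ) :
    trR (Y ⊗ₖ (1 : Matrix (Fin m) (Fin m) ℂ)) ω = trR Y (odlPT ω) := by
  have : ((Y ⊗ₖ (1 : Matrix (Fin m) (Fin m) ℂ)) * ω).trace = (Y * odlPT ω).trace := by
    simp only [Matrix.trace, Matrix.diag, Matrix.mul_apply, odlPT, Matrix.of_apply,
      Fintype.sum_prod_type, Matrix.kroneckerMap_apply, Matrix.one_apply, mul_ite, mul_one,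
      mul_zero, ite_mul, zero_mul, Finset.sum_ite_eq, Finset.mem_univ, if_true, Finset.mul_sum]
    refine Finset.sum_congr rfl fun i _ => ?_
    rw [Finset.sum_comm]
  rw [trR, trR, this]

lemma odl_pt_trace {n m : ℕ} (ω : Matrix (Fin n × Fin m) (Fin n × Fin m) ℂ) :
    (odlPT ω).trace = ω.trace := by
  simp [Matrix.trace, odlPT, Fintype.sum_prod_type]

lemma odl_povm_trR {d : Type*} [Fintype d] [DecidableEq d] {F ρ : Matrix d d ℂ}
    (hF : IsPOVMElem F) (h : IsState ρ) : 0 ≤ trR F ρ ∧ trR F ρ ≤ 1 := by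
  refine ⟨odl_trR_nonneg hF.1 h.1, ?_⟩
  rw [← odl_trR_one h]
  exact odl_trR_mono_left hF.2 h.1

/-- Spectral projections. -/
lemma odl_spectral {d : Type*} [Fintype d] [DecidableEq d] {Y : Matrix d d ℂ}
    (hY : Y.PosSemidef) (t : ℝ) :
    ∃ P : Matrix d d ℂ, P.PosSemidef ∧ (1 - P).PosSemidef ∧ P * P = P ∧
      (Y - t • P).PosSemidef ∧ (t • (1 - P) - (1 - P) * Y * (1 - P)).PosSemidef ∧
      ((∀ i, hY.1.eigenvalues i ≠ 0 → t ≤ hY.1.eigenvalues i) → Y * (1 - P) = 0) := by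
  set U : Matrix d d ℂ := (hY.1.eigenvectorUnitary : Matrix d d ℂ) with hU
  have hUU : U * Uᴴ = 1 := by
    rw [← Matrix.star_eq_conjTranspose]; exact Unitary.coe_mul_star_self _
  have hUU' : Uᴴ * U = 1 := by
    rw [← Matrix.star_eq_conjTranspose]; exact Unitary.coe_star_mul_self _
  set e := hY.1.eigenvalues with he
  have he0 : ∀ i, 0 ≤ e i := hY.eigenvalues_nonneg
  have hYe : Y = U * diagonal (fun i => (e i : ℂ)) * Uᴴ := by
    have := hY.1.spectral_theorem
    rw [Unitary.conjStarAlgAut_apply] at this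
    exact this
  set χ : d → ℂ := fun i => if t ≤ e i then 1 else 0 with hχ
  have key : ∀ a b : d → ℂ, (U * diagonal a * Uᴴ) * (U * diagonal b * Uᴴ)
      = U * diagonal (fun i => a i * b i) * Uᴴ := by
    intro a b
    calc _ = U * diagonal a * (Uᴴ * U) * diagonal b * Uᴴ := by simp only [mul_assoc]
      _ = _ := by rw [hUU', mul_one, mul_assoc U, diagonal_mul_diagonal]
  have psd : ∀ a : d → ℂ, (∀ i, 0 ≤ a i) → (U * diagonal a * Uᴴ).PosSemidef := by
    intro a ha
    exact (Matrix.posSemidef_diagonal_iff.2 ha).mul_mul_conjTranspose_same U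
  have sub : ∀ a b : d → ℂ, (U * diagonal a * Uᴴ) - (U * diagonal b * Uᴴ)
      = U * diagonal (fun i => a i - b i) * Uᴴ := by
    intro a b
    rw [← sub_mul, ← mul_sub, diagonal_sub]
  have smu : ∀ a : d → ℂ, t • (U * diagonal a * Uᴴ)
      = U * diagonal (fun i => (t : ℂ) * a i) * Uᴴ := by
    intro a
    rw [← Matrix.smul_mul, ← Matrix.mul_smul]
    congr 2
    ext i j
    simp [diagonal_apply, Matrix.smul_apply]
  have one : (1 : Matrix d d ℂ) = U * diagonal (fun _ => (1 : ℂ)) * Uᴴ := by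
    rw [diagonal_one, mul_one, hUU]
  have hQ : 1 - U * diagonal χ * Uᴴ = U * diagonal (fun i => 1 - χ i) * Uᴴ := by
    rw [one, sub]
  refine ⟨U * diagonal χ * Uᴴ, psd _ ?_, ?_, ?_, ?_, ?_, ?_⟩
  · intro i; simp only [hχ]; split_ifs <;> simp
  · rw [hQ]; apply psd; intro i; simp only [hχ]; split_ifs <;> simp
  · rw [key]; congr 3; ext i; simp only [hχ]; split_ifs <;> simp
  · rw [hYe, smu, sub]; apply psd; intro i; simp only [hχ]; split_ifs with h
    · simpa using h
    · simpa using he0 i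
  · rw [hQ, hYe, key, key, smu, sub]; apply psd; intro i; simp only [hχ]; split_ifs with h
    · simp
    · simpa using (not_le.1 h).le
  · intro h
    rw [hQ, hYe, key]
    have : (fun i => (e i : ℂ) * (1 - χ i)) = fun _ => 0 := by
      ext i; simp only [hχ]; split_ifs with h'
      · simp
      · have : e i = 0 := by
          by_contra h0; exact h' (h i h0)
        simp [this]
    rw [this]; simp

lemma odl_le_one {d : Type*} [Fintype d] [DecidableEq d] {ρ : Matrix d d ℂ} (h : IsState ρ) :
    (1 - ρ).PosSemidef := by
  set U : Matrix d d ℂ := (h.1.1.eigenvectorUnitary : Matrix d d ℂ) with hU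
  have hUU : U * Uᴴ = 1 := by
    rw [← Matrix.star_eq_conjTranspose]; exact Unitary.coe_mul_star_self _
  set e := h.1.1.eigenvalues with he
  have he0 : ∀ i, 0 ≤ e i := h.1.eigenvalues_nonneg
  have hYe : ρ = U * diagonal (fun i => (e i : ℂ)) * Uᴴ := by
    have := h.1.1.spectral_theorem
    rw [Unitary.conjStarAlgAut_apply] at this
    exact this
  have hs : ∑ i, e i = 1 := by
    have h1 := h.2.symm.trans h.1.1.trace_eq_sum_eigenvalues
    have h2 : ((∑ i, e i : ℝ) : ℂ) = 1 := by rw [h1]; simp [he]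
    exact_mod_cast h2
  have e1 : ∀ i, e i ≤ 1 := fun i => by
    rw [← hs]; exact Finset.single_le_sum (fun j _ => he0 j) (Finset.mem_univ i)
  have : 1 - ρ = U * diagonal (fun i => 1 - (e i : ℂ)) * Uᴴ := by
    rw [← diagonal_sub, mul_sub, sub_mul, ← hYe]; simp [hUU]
  rw [this]
  refine (Matrix.posSemidef_diagonal_iff.2 fun i => ?_).mul_mul_conjTranspose_same U
  have := e1 i
  simp only [sub_nonneg]
  exact_mod_cast this

lemma odl_domination {d : Type*} [Fintype d] [DecidableEq d] {ρ σ : Matrix d d ℂ}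
    (hρ : IsState ρ) (hσ : IsState σ) (hsupp : SuppLE ρ σ) :
    ∃ K : ℝ, 1 ≤ K ∧ (K • σ - ρ).PosSemidef := by
  obtain ⟨t, ht, hte⟩ : ∃ t : ℝ, 0 < t ∧
      ∀ i, hσ.1.1.eigenvalues i ≠ 0 → t ≤ hσ.1.1.eigenvalues i := by
    have h1 : ∀ i, ∀ᶠ t in nhdsWithin (0 : ℝ) (Set.Ioi 0),
        hσ.1.1.eigenvalues i ≠ 0 → t ≤ hσ.1.1.eigenvalues i := by
      intro i
      by_cases h : hσ.1.1.eigenvalues i = 0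
      · simp [h]
      · have : 0 < hσ.1.1.eigenvalues i := lt_of_le_of_ne (hσ.1.eigenvalues_nonneg i) (Ne.symm h)
        filter_upwards [Ioo_mem_nhdsGT this] with t ht _
        exact ht.2.le
    obtain ⟨t, h2, h3⟩ := ((Filter.eventually_all.2 h1).and self_mem_nhdsWithin).exists
    exact ⟨t, h3, h2⟩
  obtain ⟨P, hP, hQ, hPP, hYP, -, hY0⟩ := odl_spectral hσ.1 t
  have hz := hY0 hte
  have hρQ : ρ * (1 - P) = 0 := by
    ext i j
    have h1 : σ *ᵥ (fun k => (1 - P) k j) = 0 := by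
      ext i
      exact congrFun (congrFun hz i) j
    exact congrFun (hsupp _ h1) i
  have hρP : ρ * P = ρ := by
    rw [mul_sub, mul_one, sub_eq_zero] at hρQ; exact hρQ.symm
  have hPρ : P * ρ = ρ := by
    have := congrArg conjTranspose hρP
    rwa [conjTranspose_mul, hP.1.eq, hρ.1.1.eq] at this
  have h1 : (P - ρ).PosSemidef := by
    have := (odl_le_one hρ).mul_mul_conjTranspose_same P
    rwa [hP.1.eq, mul_sub, mul_one, hPρ, sub_mul, hPP, hρP] at this
  have h2 : (t⁻¹ • σ - P).PosSemidef := by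
    have := hYP.smul (inv_nonneg.2 ht.le)
    rwa [smul_sub, smul_smul, inv_mul_cancel₀ ht.ne', one_smul] at this
  refine ⟨max 1 t⁻¹, le_max_left _ _, ?_⟩
  have h3 := hσ.1.smul (sub_nonneg.2 (le_max_right 1 t⁻¹))
  have h4 := (h1.add h2).add h3
  convert h4 using 1
  rw [sub_smul]; abel

lemma odl_bdd {d : Type*} [Fintype d] [DecidableEq d] {ρ σ : Matrix d d ℂ}
    (hρ : IsState ρ) (hσ : IsState σ) {K : ℝ} (hK : 1 ≤ K) (hd : (K • σ - ρ).PosSemidef) :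
    BddAbove {x : ℝ | ∃ F : Matrix d d ℂ, IsPOVMElem F ∧ trR F σ ≠ 0 ∧
    x = trR F ρ * Real.logb 2 (trR F ρ / trR F σ)} := by
  refine ⟨Real.logb 2 K, ?_⟩
  rintro x ⟨F, hF, hne, rfl⟩
  obtain ⟨a0, a1⟩ := odl_povm_trR hF hρ
  obtain ⟨b0, b1⟩ := odl_povm_trR hF hσ
  have hb : 0 < trR F σ := lt_of_le_of_ne b0 hne.symm
  have hle : trR F ρ ≤ K * trR F σ := by
    rw [← odl_trR_smul_right]; exact odl_trR_mono_right hF.1 hd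
  have hlK : 0 ≤ Real.logb 2 K := Real.logb_nonneg (by norm_num) hK
  rcases a0.eq_or_lt with h | h
  · rw [← h]; simpa using hlK
  · have : Real.logb 2 (trR F ρ / trR F σ) ≤ Real.logb 2 K :=
      Real.logb_le_logb_of_le (by norm_num) (div_pos h hb) (by rw [div_le_iff₀ hb]; exact hle)
    nlinarith

lemma odl_obsDiv_nonneg {d : Type*} [Fintype d] [DecidableEq d] {ρ σ : Matrix d d ℂ}
    (hρ : IsState ρ) (hσ : IsState σ) {K : ℝ} (hK : 1 ≤ K) (hd : (K • σ - ρ).PosSemidef) :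
    0 ≤ obsDiv ρ σ := by
  refine le_csSup (odl_bdd hρ hσ hK hd) ⟨1, ⟨Matrix.PosSemidef.one, ?_⟩, ?_, ?_⟩
  · rw [sub_self]; exact Matrix.PosSemidef.zero
  · rw [odl_trR_one hσ]; norm_num
  · rw [odl_trR_one hσ, odl_trR_one hρ]; simp

/-- The lower bound extracted from the observational divergence. -/
lemma odl_test_lower {d : Type*} [Fintype d] [DecidableEq d] {ρ σ : Matrix d d ℂ}
    (hρ : IsState ρ) (hσ : IsState σ) {K : ℝ} (hK : 1 ≤ K) (hd : (K • σ - ρ).PosSemidef)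
    {E : Matrix d d ℂ} (hE : IsPOVMElem E) {p' : ℝ} (hp' : 0 < p') (h : p' ≤ trR E ρ) :
    p' * (2 : ℝ) ^ (-(obsDiv ρ σ / p')) ≤ trR E σ := by
  set q := trR E ρ with hq
  have hq0 : 0 < q := hp'.trans_le h
  have b0 := (odl_povm_trR hE hσ).1
  have hle : q ≤ K * trR E σ := by
    rw [← odl_trR_smul_right]; exact odl_trR_mono_right hE.1 hd
  have hs : 0 < trR E σ := by
    rcases b0.eq_or_lt with h | h
    · rw [← h] at hle; linarith
    · exact h
  have h1 : q * Real.logb 2 (q / trR E σ) ≤ obsDiv ρ σ :=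
    le_csSup (odl_bdd hρ hσ hK hd) ⟨E, hE, hs.ne', rfl⟩
  have hD := odl_obsDiv_nonneg hρ hσ hK hd
  have h2 : Real.logb 2 (q / trR E σ) ≤ obsDiv ρ σ / p' := by
    calc _ ≤ obsDiv ρ σ / q := by rw [le_div_iff₀ hq0]; linarith
      _ ≤ _ := by gcongr
  rw [Real.logb_le_iff_le_rpow (by norm_num) (by positivity), div_le_iff₀ hs] at h2
  rw [Real.rpow_neg (by norm_num), ← div_eq_mul_inv, div_le_iff₀ (by positivity)]
  linarith

lemma odl_split {d : Type*} [Fintype d] [DecidableEq d] {A B F : Matrix d d ℂ}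
    (hA : A.IsHermitian) (hB : B.IsHermitian) (hAB : A + B = 1) (hF : F.PosSemidef)
    {x : ℝ} (hx : 0 < x) :
    ((1 + x ^ 2) • (A * F * A) + (1 + (x ^ 2)⁻¹) • (B * F * B) - F).PosSemidef := by
  have h := hF.mul_mul_conjTranspose_same (x • A - x⁻¹ • B)
  have e1 : (x • A - x⁻¹ • B)ᴴ = x • A - x⁻¹ • B := by
    rw [conjTranspose_sub, conjTranspose_smul, conjTranspose_smul, hA.eq, hB.eq]; simp
  rw [e1] at h
  convert h using 1
  have e2 : F = (A + B) * F * (A + B) := by rw [hAB]; simp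
  have e3 : (x • A - x⁻¹ • B) * F * (x • A - x⁻¹ • B) =
      x ^ 2 • (A * F * A) + (x ^ 2)⁻¹ • (B * F * B) - A * F * B - B * F * A := by
    simp only [sub_mul, mul_sub, Matrix.smul_mul, Matrix.mul_smul, smul_smul,
      mul_inv_cancel₀ hx.ne', inv_mul_cancel₀ hx.ne', one_smul, pow_two, mul_inv]
    abel
  rw [e3]
  have e4 : F = A * F * A + B * F * B + A * F * B + B * F * A := by
    refine e2.trans ?_
    simp only [add_mul, mul_add]; abel
  generalize A * F * A = a₁ at *
  generalize B * F * B = a₂ at *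
  generalize A * F * B = a₃ at *
  generalize B * F * A = a₄ at *
  rw [e4, add_smul, add_smul, one_smul, one_smul]
  abel

lemma odl_pt_ketbra_prod {n m : ℕ} (l₀ : Fin m) (v : Fin n → ℂ) :
    odlPT (ketbra (fun q : Fin n × Fin m => if q.2 = l₀ then v q.1 else 0)) = ketbra v := by
  ext i j
  simp only [odlPT, ketbra, Matrix.of_apply]
  rw [Finset.sum_eq_single l₀]
  · simp
  · intro b _ hb; simp [hb]
  · simp

open scoped Kronecker in
lemma odl_key {n m : ℕ} (l₀ : Fin m) {ρ σ : Matrix (Fin n) (Fin n) ℂ}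
    (hρ : IsState ρ) (hσ : IsState σ) {K : ℝ} (hK : 1 ≤ K) (hd : (K • σ - ρ).PosSemidef)
    (ψ : Fin n × Fin m → ℂ) (hψ : odlPT (ketbra ψ) = ρ)
    {F : Matrix (Fin n × Fin m) (Fin n × Fin m) ℂ} (hF : IsPOVMElem F)
    {Y : Matrix (Fin n) (Fin n) ℂ} (hY : Y.IsHermitian)
    (hYF : (Y ⊗ₖ (1 : Matrix (Fin m) (Fin m) ℂ) - F).PosSemidef)
    {α β : ℝ} (hα : 0 < α) (hαβ : α < β) (hp : β ^ 2 ≤ trR F (ketbra ψ)) :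
    (β - α) ^ 2 * (α ^ 2 * (2 : ℝ) ^ (-(obsDiv ρ σ / α ^ 2))) ≤ trR Y σ := by
  have hYp : Y.PosSemidef := by
    refine odl_psd_of_re hY fun v => ?_
    rw [← odl_pt_ketbra_prod l₀ v, ← odl_trR_kron]
    exact (odl_trR_nonneg hF.1 (odl_ketbra_psd _)).trans
      (odl_trR_mono_left hYF (odl_ketbra_psd _))
  set t := (β - α) ^ 2 with ht
  have ht0 : 0 < t := by rw [ht]; have := sub_pos.2 hαβ; positivity
  obtain ⟨P, hP, hQ, hPP, hYP, hQY, -⟩ := odl_spectral hYp t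
  have hmain : α ^ 2 ≤ trR P ρ := by
    by_contra hlt
    push Not at hlt
    set A : Matrix (Fin n × Fin m) (Fin n × Fin m) ℂ := P ⊗ₖ (1 : Matrix (Fin m) (Fin m) ℂ) with hA
    set B : Matrix (Fin n × Fin m) (Fin n × Fin m) ℂ :=
      (1 - P) ⊗ₖ (1 : Matrix (Fin m) (Fin m) ℂ) with hB
    have hAp : A.PosSemidef := hP.kronecker Matrix.PosSemidef.one
    have hBp : B.PosSemidef := hQ.kronecker Matrix.PosSemidef.one
    have hAB : A + B = 1 := by
      rw [hA, hB, ← Matrix.add_kronecker, add_sub_cancel, Matrix.one_kronecker_one]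
    have hAA : A * A = A := by
      rw [hA, ← Matrix.mul_kronecker_mul, hPP, one_mul]
    have h1 : (A - A * F * A).PosSemidef := by
      have := hF.2.mul_mul_conjTranspose_same A
      rwa [hAp.1.eq, mul_sub, mul_one, sub_mul, hAA] at this
    have h2 : (B * (Y ⊗ₖ (1 : Matrix (Fin m) (Fin m) ℂ)) * B - B * F * B).PosSemidef := by
      have := hYF.mul_mul_conjTranspose_same B
      rwa [hBp.1.eq, mul_sub, sub_mul] at this
    have h3 : (t • B - B * (Y ⊗ₖ (1 : Matrix (Fin m) (Fin m) ℂ)) * B).PosSemidef := by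
      have := hQY.kronecker (Matrix.PosSemidef.one (R := ℂ) (n := Fin m))
      have e : t • B - B * (Y ⊗ₖ (1 : Matrix (Fin m) (Fin m) ℂ)) * B =
          (t • (1 - P) - (1 - P) * Y * (1 - P)) ⊗ₖ (1 : Matrix (Fin m) (Fin m) ℂ) := by
        rw [hB, ← Matrix.mul_kronecker_mul, ← Matrix.mul_kronecker_mul, one_mul, one_mul]
        ext ⟨i, k⟩ ⟨j, l⟩
        simp only [Matrix.sub_apply, Matrix.smul_apply, Matrix.kroneckerMap_apply, sub_mul,
          smul_mul_assoc]
      rw [e]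
      exact this
    set x := Real.sqrt ((β - α) / α) with hx
    have hx0 : 0 < x := Real.sqrt_pos.2 (div_pos (sub_pos.2 hαβ) hα)
    have hx2 : x ^ 2 = (β - α) / α := Real.sq_sqrt (div_pos (sub_pos.2 hαβ) hα).le
    have h4 := odl_split hAp.1 hBp.1 hAB hF.1 hx0
    have k := odl_ketbra_psd ψ
    have g1 := odl_trR_mono_left h1 k
    have g2 := odl_trR_mono_left h2 k
    have g3 := odl_trR_mono_left h3 k
    have g4 := odl_trR_mono_left h4 k
    rw [odl_trR_smul_left] at g3
    rw [odl_trR_add_left, odl_trR_smul_left, odl_trR_smul_left] at g4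
    have gA : trR A (ketbra ψ) = trR P ρ := by rw [hA, odl_trR_kron, hψ]
    have gB : trR B (ketbra ψ) ≤ 1 := by
      rw [hB, odl_trR_kron, hψ, odl_trR_sub_left, odl_trR_one hρ]
      linarith [odl_trR_nonneg hP hρ.1]
    have e1 : 1 + x ^ 2 = β / α := by rw [hx2]; field_simp; ring
    have hba : 0 < β - α := sub_pos.2 hαβ
    have e2 : 1 + (x ^ 2)⁻¹ = β / (β - α) := by rw [hx2]; field_simp; ring
    rw [e1, e2] at g4
    have hβ : 0 < β := hα.trans hαβ
    have f1 : β / α * trR (A * F * A) (ketbra ψ) < β * α := by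
      calc _ ≤ β / α * trR P ρ := by rw [← gA]; gcongr
        _ < β / α * α ^ 2 := by gcongr
        _ = _ := by field_simp
    have f2 : β / (β - α) * trR (B * F * B) (ketbra ψ) ≤ β * (β - α) := by
      calc _ ≤ β / (β - α) * t := by
            gcongr
            nlinarith
        _ = _ := by rw [ht]; field_simp
    nlinarith
  have hl := odl_test_lower hρ hσ hK hd ⟨hP, hQ⟩ (by positivity) hmain
  have h5 := odl_trR_mono_left hYP (B := σ) hσ.1
  rw [odl_trR_smul_left] at h5
  exact (mul_le_mul_of_nonneg_left hl ht0.le).trans h5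

lemma odl_continuous_trR {d X : Type*} [Fintype d] [TopologicalSpace X] {f g : X → Matrix d d ℂ}
    (hf : Continuous f) (hg : Continuous g) : Continuous (fun x => trR (f x) (g x)) := by
  unfold trR
  exact Complex.continuous_re.comp (Continuous.matrix_trace (hf.matrix_mul hg))

lemma odl_state_entry {d : Type*} [Fintype d] [DecidableEq d] {ω : Matrix d d ℂ} (h : IsState ω)
    (i j : d) : ‖ω i j‖ ≤ 1 := by
  have h1 : trR ω ω ≤ 1 := by
    rw [← odl_trR_one h]; exact odl_trR_mono_left (odl_le_one h) h.1
  have h2 : trR ω ω = ∑ i, ∑ j, ‖ω i j‖ ^ 2 := by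
    have : trR ω ω = trR ω ωᴴ := by rw [h.1.1.eq]
    rw [this, trR]
    simp only [Matrix.trace, Matrix.diag, Matrix.mul_apply, conjTranspose_apply, Complex.re_sum,
      RCLike.star_def, Complex.mul_conj, Complex.ofReal_re, Complex.normSq_eq_norm_sq]
  have h3 : ‖ω i j‖ ^ 2 ≤ ∑ i, ∑ j, ‖ω i j‖ ^ 2 :=
    (Finset.single_le_sum (f := fun j => ‖ω i j‖ ^ 2) (fun _ _ => by positivity)
      (Finset.mem_univ j)).trans
    (Finset.single_le_sum (f := fun i => ∑ j, ‖ω i j‖ ^ 2)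
      (fun _ _ => Finset.sum_nonneg fun _ _ => by positivity) (Finset.mem_univ i))
  have h4 : ‖ω i j‖ ^ 2 ≤ 1 := by linarith
  nlinarith [norm_nonneg (ω i j)]

lemma odl_states_compact {d : Type*} [Fintype d] [DecidableEq d] :
    IsCompact {ω : Matrix d d ℂ | IsState ω} := by
  have hbox : IsCompact (Set.univ.pi fun _ : d => Set.univ.pi fun _ : d =>
      Metric.closedBall (0 : ℂ) 1) :=
    isCompact_univ_pi fun _ => isCompact_univ_pi fun _ => isCompact_closedBall _ _
  refine IsCompact.of_isClosed_subset (X := d → d → ℂ) hbox ?_ ?_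
  · have : {ω : Matrix d d ℂ | IsState ω} = {ω : Matrix d d ℂ | ωᴴ = ω} ∩
        ({ω : Matrix d d ℂ | ∀ v : d → ℂ, 0 ≤ trR ω (ketbra v)} ∩
          {ω : Matrix d d ℂ | ω.trace = 1}) := by
      ext ω
      constructor
      · rintro h
        exact ⟨h.1.1.eq, fun v => odl_trR_nonneg h.1 (odl_ketbra_psd v), h.2⟩
      · rintro ⟨h1, h2, h3⟩
        exact ⟨odl_psd_of_re h1 h2, h3⟩
    have hc : IsClosed {ω : Matrix d d ℂ | IsState ω} := by
      rw [this]
      refine IsClosed.inter (isClosed_eq (Continuous.matrix_conjTranspose continuous_id)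
        continuous_id) (IsClosed.inter ?_
          (isClosed_eq (Continuous.matrix_trace continuous_id) continuous_const))
      simp only [Set.ofPred_forall]
      refine isClosed_iInter fun v => isClosed_le continuous_const ?_
      exact odl_continuous_trR continuous_id continuous_const
    exact hc
  · intro ω hω i _ j _
    simpa using odl_state_entry hω i j

lemma odl_states_convex {d : Type*} [Fintype d] [DecidableEq d] :
    Convex ℝ {ω : Matrix d d ℂ | IsState ω} := by
  intro x hx y hy a b ha hb hab
  refine ⟨(hx.1.smul ha).add (hy.1.smul hb), ?_⟩
  rw [trace_add, trace_smul, trace_smul, hx.2, hy.2, ← add_smul, hab, one_smul]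

lemma odl_povm_convex {d : Type*} [Fintype d] [DecidableEq d] :
    Convex ℝ {F : Matrix d d ℂ | IsPOVMElem F} := by
  intro x hx y hy a b ha hb hab
  refine ⟨(hx.1.smul ha).add (hy.1.smul hb), ?_⟩
  have := (hx.2.smul ha).add (hy.2.smul hb)
  convert this using 1
  rw [smul_sub, smul_sub, sub_add_sub_comm, ← add_smul, hab, one_smul]

lemma odl_povm_one {d : Type*} [Fintype d] [DecidableEq d] : IsPOVMElem (1 : Matrix d d ℂ) :=
  ⟨Matrix.PosSemidef.one, by rw [sub_self]; exact Matrix.PosSemidef.zero⟩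

/-- Minimax in the form used below. -/
lemma odl_minimax {E G : Type*} [TopologicalSpace E] [AddCommGroup E] [Module ℝ E]
    [IsTopologicalAddGroup E] [ContinuousSMul ℝ E]
    [TopologicalSpace G] [AddCommGroup G] [Module ℝ G]
    [IsTopologicalAddGroup G] [ContinuousSMul ℝ G]
    {X : Set E} {Y : Set G} {f : E → G → ℝ} (ne_X : X.Nonempty) (cX : Convex ℝ X)
    (kX : IsCompact X) (cY : Convex ℝ Y)
    (hc1 : ∀ y ∈ Y, Continuous fun x => f x y) (hc2 : ∀ x ∈ X, Continuous fun y => f x y)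
    (hx1 : ∀ y ∈ Y, ConvexOn ℝ X fun x => f x y) (hx2 : ∀ x ∈ X, ConcaveOn ℝ Y fun y => f x y)
    {t : ℝ} (h : ∀ x ∈ X, ∃ y ∈ Y, t < f x y) : ∃ y ∈ Y, ∀ x ∈ X, t < f x y := by
  have hfy : ∀ y ∈ Y, LowerSemicontinuousOn (fun x : E ↦ f x y) X :=
    fun y hy => (hc1 y hy).lowerSemicontinuous.lowerSemicontinuousOn X
  have : ∃ s : Finset Y, ∀ x ∈ X, ∃ i ∈ s, t < f x i := by
    rw [← LowerSemicontinuousOn.inter_biInter_preimage_Iic_eq_empty_iff_exists_finset kX hfy]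
    apply Set.eq_empty_of_forall_notMem
    rintro x ⟨hx, hx'⟩
    simp only [Set.mem_iInter, Set.mem_preimage, Set.mem_Iic] at hx'
    obtain ⟨y, hy, hlt⟩ := h x hx
    exact absurd (hx' y hy) (not_le.2 hlt)
  obtain ⟨s, hs⟩ := this
  have hs' (x) (hx : x ∈ X) : ∃ y ∈ Subtype.val '' (s : Set Y), t < f x y := by
    obtain ⟨i, hi, hi'⟩ := hs x hx
    use i.val
    simp [hi, hi']
  exact Sion.exists_lt_iInf_of_lt_iInf_of_finite ne_X kX hfy
    (fun y hy => (hx1 y hy).quasiconvexOn) cY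
    (fun x hx => (hc2 x hx).upperSemicontinuous.upperSemicontinuousOn Y)
    (fun x hx => (hx2 x hx).quasiconcaveOn) cX (Set.toFinite _) (Subtype.coe_image_subset Y ↑s) hs'

lemma odl_trR_self_zero {d : Type*} [Fintype d] [DecidableEq d] {A : Matrix d d ℂ}
    (hA : A.IsHermitian) (h : trR A A ≤ 0) : A = 0 := by
  have h2 : trR A A = ∑ i, ∑ j, ‖A i j‖ ^ 2 := by
    have : trR A A = trR A Aᴴ := by rw [hA.eq]
    rw [this, trR]
    simp only [Matrix.trace, Matrix.diag, Matrix.mul_apply, conjTranspose_apply, Complex.re_sum,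
      RCLike.star_def, Complex.mul_conj, Complex.ofReal_re, Complex.normSq_eq_norm_sq]
  ext i j
  have h3 : ‖A i j‖ ^ 2 ≤ ∑ i, ∑ j, ‖A i j‖ ^ 2 :=
    (Finset.single_le_sum (f := fun j => ‖A i j‖ ^ 2) (fun _ _ => by positivity)
      (Finset.mem_univ j)).trans
    (Finset.single_le_sum (f := fun i => ∑ j, ‖A i j‖ ^ 2)
      (fun _ _ => Finset.sum_nonneg fun _ _ => by positivity) (Finset.mem_univ i))
  have h4 : ‖A i j‖ ^ 2 ≤ 0 := by linarith
  have : ‖A i j‖ = 0 := by nlinarith [norm_nonneg (A i j)]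
  simpa using this

lemma odl_pt_herm {n m : ℕ} {ω : Matrix (Fin n × Fin m) (Fin n × Fin m) ℂ}
    (h : ω.IsHermitian) : (odlPT ω).IsHermitian := by
  ext i j
  simp only [odlPT, conjTranspose_apply, Matrix.of_apply, star_sum]
  exact Finset.sum_congr rfl fun l _ => h.apply _ _

open scoped Kronecker in
lemma odl_single {n m : ℕ} (l₀ : Fin m) {ρ σ : Matrix (Fin n) (Fin n) ℂ}
    (hρ : IsState ρ) (hσ : IsState σ) {K : ℝ} (hK : 1 ≤ K) (hd : (K • σ - ρ).PosSemidef)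
    (ψ : Fin n × Fin m → ℂ) (hψ : odlPT (ketbra ψ) = ρ) (hψs : IsState (ketbra ψ))
    {α β : ℝ} (hα : 0 < α) (hαβ : α < β) (hβ : β ≤ 1) :
    ∃ ω : Matrix (Fin n × Fin m) (Fin n × Fin m) ℂ, IsState ω ∧ odlPT ω = σ ∧
      ∀ F, IsPOVMElem F → β ^ 2 ≤ trR F (ketbra ψ) →
        (β - α) ^ 2 * (α ^ 2 * (2 : ℝ) ^ (-(obsDiv ρ σ / α ^ 2))) ≤ trR F ω := by
  set c := (β - α) ^ 2 * (α ^ 2 * (2 : ℝ) ^ (-(obsDiv ρ σ / α ^ 2))) with hc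
  set X : Set (Matrix (Fin n × Fin m) (Fin n × Fin m) ℂ) := {ω | IsState ω} with hX
  set S : Set (Matrix (Fin n × Fin m) (Fin n × Fin m) ℂ × Matrix (Fin n) (Fin n) ℂ) :=
    {y | IsPOVMElem y.1 ∧ β ^ 2 ≤ trR y.1 (ketbra ψ) ∧ y.2.IsHermitian} with hS
  set f : Matrix (Fin n × Fin m) (Fin n × Fin m) ℂ →
      Matrix (Fin n × Fin m) (Fin n × Fin m) ℂ × Matrix (Fin n) (Fin n) ℂ → ℝ :=
    fun ω y => trR y.2 (odlPT ω) - trR y.1 ω - trR y.2 σ with hf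
  have neX : X.Nonempty := ⟨_, hψs⟩
  have cS : Convex ℝ S := by
    intro x hx y hy a b ha hb hab
    refine ⟨odl_povm_convex hx.1 hy.1 ha hb hab, ?_, ?_⟩
    · simp only [Prod.fst_add, Prod.smul_fst, odl_trR_add_left, odl_trR_smul_left]
      have h1 := mul_le_mul_of_nonneg_left hx.2.1 ha
      have h2 := mul_le_mul_of_nonneg_left hy.2.1 hb
      have h3 : β ^ 2 = a * β ^ 2 + b * β ^ 2 := by rw [← add_mul, hab, one_mul]
      linarith
    · have h1 := hx.2.2
      have h2 := hy.2.2
      simp only [Prod.snd_add, Prod.smul_snd, Matrix.IsHermitian, conjTranspose_add,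
        conjTranspose_smul, h1.eq, h2.eq, star_trivial]
  have hc1 : ∀ y ∈ S, Continuous fun x => f x y := by
    intro y _
    simp only [hf, ← odl_trR_kron]
    refine Continuous.sub (Continuous.sub ?_ ?_) continuous_const
    · exact odl_continuous_trR continuous_const continuous_id
    · exact odl_continuous_trR continuous_const continuous_id
  have hc2 : ∀ x ∈ X, Continuous fun y => f x y := by
    intro x _
    simp only [hf]
    refine Continuous.sub (Continuous.sub ?_ ?_) ?_
    · exact odl_continuous_trR continuous_snd continuous_const
    · exact odl_continuous_trR continuous_fst continuous_const
    · exact odl_continuous_trR continuous_snd continuous_const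
  have hx1 : ∀ y ∈ S, ConvexOn ℝ X fun x => f x y := by
    intro y _
    refine ⟨odl_states_convex, fun x _ z _ a b _ _ hab => le_of_eq ?_⟩
    simp only [hf, ← odl_trR_kron, odl_trR_add_right, odl_trR_smul_right, smul_eq_mul]
    obtain rfl : b = 1 - a := by linarith
    ring
  have hx2 : ∀ x ∈ X, ConcaveOn ℝ S fun y => f x y := by
    intro x _
    refine ⟨cS, fun y _ z _ a b _ _ hab => le_of_eq ?_⟩
    simp only [hf, Prod.fst_add, Prod.smul_fst, Prod.snd_add, Prod.smul_snd,
      odl_trR_add_left, odl_trR_smul_left, smul_eq_mul]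
    ring
  have hex : ∃ ω ∈ X, ∀ y ∈ S, f ω y ≤ -c := by
    by_contra hcon
    push Not at hcon
    obtain ⟨⟨F, Y⟩, ⟨hF, hFp, hY⟩, hall⟩ :=
      odl_minimax neX odl_states_convex odl_states_compact cS hc1 hc2 hx1 hx2 hcon
    obtain ⟨ω₀, hω₀, hmin⟩ := odl_states_compact.exists_isMinOn neX
      (hc1 (F, Y) ⟨hF, hFp, hY⟩).continuousOn
    have h0 := hall ω₀ hω₀
    simp only at hF hFp hY
    set s := - f ω₀ (F, Y) with hs
    set u := s - trR Y σ with hu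
    have hY' : (Y + u • (1 : Matrix (Fin n) (Fin n) ℂ)).IsHermitian := by
      have h1 : (1 : Matrix (Fin n) (Fin n) ℂ).IsHermitian := Matrix.isHermitian_one
      simp only [Matrix.IsHermitian, conjTranspose_add,
        conjTranspose_smul, hY.eq, h1.eq, star_trivial]
    have hpsd : ((Y + u • (1 : Matrix (Fin n) (Fin n) ℂ)) ⊗ₖ (1 : Matrix (Fin m) (Fin m) ℂ)
        - F).PosSemidef := by
      refine odl_psd_of_re ?_ fun v => ?_
      · refine Matrix.IsHermitian.sub ?_ hF.1.1
        rw [Matrix.IsHermitian, Matrix.conjTranspose_kronecker, hY'.eq, conjTranspose_one]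
      · have hN : ((ketbra v).trace) = (((ketbra v).trace.re : ℝ) : ℂ) := by
          have := (odl_ketbra_psd v).trace_nonneg
          apply Complex.ext
          · simp
          · simpa using (Complex.le_def.1 this).2.symm
        set N := (ketbra v).trace.re with hNdef
        have hN0 : 0 ≤ N := (Complex.le_def.1 (odl_ketbra_psd v).trace_nonneg).1
        rcases hN0.eq_or_lt with hz | hpos
        · have : ketbra v = 0 := by
            rw [← (odl_ketbra_psd v).trace_eq_zero_iff, hN, ← hz]; simp
          rw [this]; simp [trR]
        · have hst : IsState (N⁻¹ • ketbra v) := by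
            refine ⟨(odl_ketbra_psd v).smul (inv_nonneg.2 hpos.le), ?_⟩
            rw [trace_smul, hN, Complex.real_smul, ← Complex.ofReal_mul,
              inv_mul_cancel₀ hpos.ne', Complex.ofReal_one]
          have h5 : f ω₀ (F, Y) ≤ f (N⁻¹ • ketbra v) (F, Y) := hmin hst
          have h6 : trR (1 : Matrix (Fin n) (Fin n) ℂ) (odlPT (ketbra v)) = N := by
            rw [trR, one_mul, odl_pt_trace]
          rw [odl_trR_sub_left, odl_trR_kron, odl_trR_add_left, odl_trR_smul_left, h6]
          have h7 : f (N⁻¹ • ketbra v) (F, Y) =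
              N⁻¹ * (trR Y (odlPT (ketbra v)) - trR F (ketbra v)) - trR Y σ := by
            simp only [hf, ← odl_trR_kron, odl_trR_smul_right]
            ring
          rw [h7] at h5
          have h8 : 0 ≤ u + N⁻¹ * (trR Y (odlPT (ketbra v)) - trR F (ketbra v)) := by
            rw [hu, hs]; linarith
          have h9 := mul_nonneg hpos.le h8
          rw [mul_add, mul_inv_cancel_left₀ hpos.ne'] at h9
          linarith
    have hk := odl_key l₀ hρ hσ hK hd ψ hψ hF hY' hpsd hα hαβ hFp
    rw [odl_trR_add_left, odl_trR_smul_left, odl_trR_one hσ] at hk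
    have : trR Y σ + u * 1 = s := by rw [hu]; ring
    rw [this] at hk
    linarith
  obtain ⟨ω, hω, hall⟩ := hex
  have hω' : IsState ω := hω
  have h1in : β ^ 2 ≤ trR 1 (ketbra ψ) := by
    rw [odl_trR_one hψs]; nlinarith
  have hΔh : (odlPT ω - σ).IsHermitian := (odl_pt_herm hω'.1.1).sub hσ.1.1
  have hpt : odlPT ω - σ = 0 := by
    apply odl_trR_self_zero hΔh
    by_contra hpos
    push Not at hpos
    set g := trR (odlPT ω - σ) (odlPT ω - σ) with hg
    set s := (2 + |c|) / g with hs
    have hmem : ((1 : Matrix (Fin n × Fin m) (Fin n × Fin m) ℂ), s • (odlPT ω - σ)) ∈ S := by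
      refine ⟨odl_povm_one, h1in, ?_⟩
      simp only [Matrix.IsHermitian, conjTranspose_smul, hΔh.eq, star_trivial]
    have h2 := hall _ hmem
    simp only [hf] at h2
    rw [odl_trR_one hω', odl_trR_smul_left, odl_trR_smul_left] at h2
    have h3 : s * trR (odlPT ω - σ) (odlPT ω) - s * trR (odlPT ω - σ) σ = 2 + |c| := by
      rw [← mul_sub, ← odl_trR_sub_right, ← hg, hs, div_mul_cancel₀ _ hpos.ne']
    have := neg_abs_le c
    have := le_abs_self c
    linarith
  refine ⟨ω, hω, sub_eq_zero.1 hpt, fun F hF hFp => ?_⟩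
  have := hall (F, 0) ⟨hF, hFp, Matrix.isHermitian_zero⟩
  simp only [hf] at this
  have z : ∀ M : Matrix (Fin n) (Fin n) ℂ, trR 0 M = 0 := by intro M; simp [trR]
  rw [z, z] at this
  linarith

lemma odl_neg_mul_logb {p : ℝ} (hp : 0 < p) (hp1 : p ≤ 1) :
    p * -Real.logb 2 p ≤ 2 * (1 - p) := by
  have h1 := Real.one_sub_inv_le_log_of_pos hp
  have h2 : p * -Real.log p ≤ 1 - p := by
    have := mul_le_mul_of_nonneg_left h1 hp.le
    rw [mul_sub, mul_inv_cancel₀ hp.ne'] at this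
    linarith
  have hl : (1 : ℝ) / 2 < Real.log 2 := by have := Real.log_two_gt_d9; linarith
  have hl0 : 0 < Real.log 2 := by linarith
  have : p * -Real.logb 2 p = (p * -Real.log p) / Real.log 2 := by
    rw [Real.logb]; ring
  rw [this, div_le_iff₀ hl0]
  nlinarith

lemma odl_logb_one_add {z : ℝ} (h0 : 0 ≤ z) (h1 : z ≤ 1) : z ≤ Real.logb 2 (1 + z) := by
  rw [Real.le_logb_iff_rpow_le (by norm_num) (by linarith)]
  have := _root_.rpow_one_add_le_one_add_mul_self (s := 1) (by norm_num) h0 h1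
  norm_num at this
  exact this

lemma odl_k_bound {x p : ℝ} (hx : 1 ≤ x) (hp : 0 < p) {k : ℕ}
    (hk : p ≤ ((1 + 1 / x)⁻¹) ^ k) : (k : ℝ) ≤ x * -Real.logb 2 p := by
  have hx0 : 0 < x := by linarith
  have h1 : 1 / x ≤ Real.logb 2 (1 + 1 / x) :=
    odl_logb_one_add (by positivity) (by rw [div_le_one hx0]; exact hx)
  have h2 : Real.logb 2 p ≤ -(k * Real.logb 2 (1 + 1 / x)) := by
    have := Real.logb_le_logb_of_le (b := 2) (by norm_num) hp hk
    rwa [Real.logb_pow, Real.logb_inv, mul_neg] at this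
  have h3 : (k : ℝ) * (1 / x) ≤ k * Real.logb 2 (1 + 1 / x) := by gcongr
  have h4 : (k : ℝ) * (1 / x) ≤ -Real.logb 2 p := by linarith
  have h5 := mul_le_mul_of_nonneg_left h4 hx0.le
  have h6 : x * ((k : ℝ) * (1 / x)) = k := by field_simp
  linarith

lemma odl_numeric {D x r y p τ b : ℝ} {k : ℕ} (hD : 0 ≤ D) (hx : 1 ≤ x) (hxD : x ^ 2 = D + 1)
    (hr : r = 1 + 1 / x) (hy : 0 < y) (hyr : y ^ 2 = r) (hp : 0 < p) (hp1 : p ≤ 1) (hτ : 0 < τ)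
    (hk : p ≤ (r⁻¹) ^ k) (hb : b = (r⁻¹) ^ (k + 1))
    (h : (1 / 2 : ℝ) ^ (k + 1) * (b * (1 - 1 / y) ^ 2 * (b / r * (2 : ℝ) ^ (-(D * r / b)))) ≤ τ) :
    p * Real.logb 2 (p / τ) ≤
      D * r ^ 2 + max (1 + Real.logb 2 96 + Real.logb 2 (D + 1)) (2 + 2 * x) := by
  have hx0 : 0 < x := by linarith
  have hr1 : 1 < r := by rw [hr]; have : 0 < 1 / x := by positivity
                         linarith
  have hr0 : 0 < r := by linarith
  have hr2 : r ≤ 2 := by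
    rw [hr]; have : 1 / x ≤ 1 := by rw [div_le_one hx0]; exact hx
    linarith
  have hy1 : 1 < y := by nlinarith
  have hy2 : y ≤ 3 / 2 := by nlinarith
  have hb0 : 0 < b := by rw [hb]; positivity
  have hrb : p ≤ r * b := by
    have : r * b = (r⁻¹) ^ k := by rw [hb, pow_succ]; field_simp
    rw [this]; exact hk
  have hiy : 0 < 1 - 1 / y := by
    have : 1 / y < 1 := by rw [div_lt_one hy]; exact hy1
    linarith
  set W := 1 - 1 / y with hW
  have hWx : W * ((r + y) * x) = 1 := by
    have h1 : (r - 1) * x = 1 := by rw [hr]; field_simp; ring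
    have h2 : W * y = y - 1 := by rw [hW]; field_simp
    have h3 : r + y = y * (y + 1) := by rw [← hyr]; ring
    rw [h3]
    calc W * (y * (y + 1) * x) = (W * y) * (y + 1) * x := by ring
      _ = (y ^ 2 - 1) * x := by rw [h2]; ring
      _ = 1 := by rw [hyr, h1]
  have hr3 : r ^ 3 ≤ 96 * (D + 1) * W ^ 2 := by
    have e1 : r ^ 3 * (r + y) ^ 2 ≤ 96 := by
      have i1 : r ^ 3 ≤ 2 ^ 3 := by gcongr
      have i2 : (r + y) ^ 2 ≤ 12 := by nlinarith
      nlinarith [pow_pos hr0 3, sq_nonneg (r + y)]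
    have e2 : (D + 1) * W ^ 2 * (r + y) ^ 2 = 1 := by
      rw [← hxD]
      calc _ = (W * ((r + y) * x)) ^ 2 := by ring
        _ = 1 := by rw [hWx]; norm_num
    have e3 : 0 < (D + 1) * W ^ 2 := by positivity
    calc r ^ 3 = r ^ 3 * ((D + 1) * W ^ 2 * (r + y) ^ 2) := by rw [e2, mul_one]
      _ = (r ^ 3 * (r + y) ^ 2) * ((D + 1) * W ^ 2) := by ring
      _ ≤ 96 * ((D + 1) * W ^ 2) := by gcongr
      _ = _ := by ring
  have hD1 : 0 < D + 1 := by linarith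
  have l3 : 3 * Real.logb 2 r ≤ Real.logb 2 96 + Real.logb 2 (D + 1) + 2 * Real.logb 2 W := by
    have := Real.logb_le_logb_of_le (b := 2) (by norm_num) (by positivity) hr3
    rw [Real.logb_pow, Real.logb_mul (by positivity) (by positivity),
      Real.logb_mul (by positivity) (by positivity), Real.logb_pow] at this
    push_cast at this
    exact this
  have lτ := Real.logb_le_logb_of_le (b := 2) (by norm_num) (by positivity) h
  rw [Real.logb_mul (by positivity) (by positivity), Real.logb_mul (by positivity) (by positivity),
    Real.logb_mul (by positivity) (by positivity), Real.logb_mul (by positivity) (by positivity),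
    Real.logb_div (by positivity) (by positivity), Real.logb_pow, Real.logb_pow,
    Real.logb_rpow (by norm_num) (by norm_num), one_div, Real.logb_inv,
    Real.logb_self_eq_one (by norm_num)] at lτ
  push_cast at lτ
  have lb : Real.logb 2 p ≤ Real.logb 2 r + Real.logb 2 b := by
    rw [← Real.logb_mul (by positivity) (by positivity)]
    exact Real.logb_le_logb_of_le (by norm_num) hp hrb
  have hkx : (k : ℝ) ≤ x * -Real.logb 2 p := odl_k_bound hx hp (by rw [← hr]; exact hk)
  have hpl := odl_neg_mul_logb hp hp1
  have hDr : p * (D * r / b) ≤ D * r ^ 2 := by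
    rw [mul_div_assoc', div_le_iff₀ hb0]
    have : 0 ≤ D * r := by positivity
    nlinarith
  have hlog : Real.logb 2 (p / τ) ≤
      (1 + Real.logb 2 96 + Real.logb 2 (D + 1)) + (1 + x) * -Real.logb 2 p + D * r / b := by
    rw [Real.logb_div hp.ne' hτ.ne']
    linarith
  have h1 := mul_le_mul_of_nonneg_left hlog hp.le
  set M1 := 1 + Real.logb 2 96 + Real.logb 2 (D + 1) with hM1
  have h2 : (1 + x) * (p * -Real.logb 2 p) ≤ (1 + x) * (2 * (1 - p)) := by gcongr
  have h3 : p * M1 ≤ p * max M1 (2 + 2 * x) := by gcongr; exact le_max_left _ _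
  have h4 : (1 - p) * (2 + 2 * x) ≤ (1 - p) * max M1 (2 + 2 * x) :=
    mul_le_mul_of_nonneg_left (le_max_right _ _) (by linarith)
  have h5 : p * max M1 (2 + 2 * x) + (1 - p) * max M1 (2 + 2 * x) = max M1 (2 + 2 * x) := by ring
  calc _ ≤ _ := h1
    _ = p * M1 + (1 + x) * (p * -Real.logb 2 p) + p * (D * r / b) := by ring
    _ ≤ _ := by linarith

lemma odl_final_bound {D x r : ℝ} (hD : 0 ≤ D) (hx : 1 ≤ x) (hxD : x ^ 2 = D + 1)
    (hr : r = 1 + 1 / x) :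
    D * r ^ 2 + max (1 + Real.logb 2 96 + Real.logb 2 (D + 1)) (2 + 2 * x) <
      D + 4 * x + 2 * Real.logb 2 (D + 1) + 4 := by
  have hx0 : 0 < x := by linarith
  have hz : 0 < 1 / x := by positivity
  set z := 1 / x with hzdef
  have hzx : z * x = 1 := by rw [hzdef]; field_simp
  have hz1 : z ≤ 1 := by rw [hzdef, div_le_one hx0]; exact hx
  have e1 : D * r ^ 2 = D + 1 + 2 * x - 2 * z - z ^ 2 := by
    have : D = x ^ 2 - 1 := by linarith
    rw [this, hr]
    linear_combination (2 * x + z * x + 1) * hzx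
  have l96 : Real.logb 2 96 < 7 := by
    rw [Real.logb_lt_iff_lt_rpow (by norm_num) (by norm_num)]; norm_num
  have hD1 : 0 < D + 1 := by linarith
  have la : 1 - z ^ 2 ≤ Real.logb 2 (D + 1) := by
    have h1 := Real.one_sub_inv_le_log_of_pos hD1
    have h2 : (D + 1)⁻¹ = z ^ 2 := by rw [← hxD, hzdef]; field_simp
    rw [h2] at h1
    have hl : Real.log 2 ≤ 1 := by have := Real.log_two_lt_d9; linarith
    have hl0 : 0 < Real.log 2 := Real.log_pos (by norm_num)
    have h3 : 0 ≤ Real.log (D + 1) := Real.log_nonneg (by linarith)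
    refine h1.trans ?_
    rw [Real.logb, le_div_iff₀ hl0]
    nlinarith
  have la0 : 0 ≤ Real.logb 2 (D + 1) := Real.logb_nonneg (by norm_num) (by linarith)
  have hxz : 2 ≤ x + z := by nlinarith [sq_nonneg (x - 1)]
  rw [e1]
  rcases max_cases (1 + Real.logb 2 96 + Real.logb 2 (D + 1)) (2 + 2 * x) with ⟨h, -⟩ | ⟨h, -⟩
  · rw [h]; linarith
  · rw [h]; nlinarith

lemma odl_mix {n m : ℕ} {σ : Matrix (Fin n) (Fin n) ℂ}
    (ωi : Matrix (Fin n × Fin m) (Fin n × Fin m) ℂ) (hωi : IsState ωi ∧ odlPT ωi = σ) (N : ℕ) :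
    ∀ w : ℕ → Matrix (Fin n × Fin m) (Fin n × Fin m) ℂ, (∀ k, IsState (w k) ∧ odlPT (w k) = σ) →
    ∃ ω, (IsState ω ∧ odlPT ω = σ) ∧ ∀ F : Matrix (Fin n × Fin m) (Fin n × Fin m) ℂ,
      F.PosSemidef → (∀ k < N, (1 / 2 : ℝ) ^ (k + 1) * trR F (w k) ≤ trR F ω) ∧
        (1 / 2 : ℝ) ^ N * trR F ωi ≤ trR F ω := by
  induction N with
  | zero =>
    intro w _
    exact ⟨ωi, hωi, fun F _ => ⟨fun k hk => absurd hk (Nat.not_lt_zero k), by simp⟩⟩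
  | succ N ih =>
    intro w hw
    obtain ⟨ω', ⟨hs', hp'⟩, h'⟩ := ih (fun k => w (k + 1)) (fun k => hw (k + 1))
    refine ⟨(1 / 2 : ℝ) • w 0 + (1 / 2 : ℝ) • ω', ⟨?_, ?_⟩, ?_⟩
    · exact odl_states_convex (hw 0).1 hs' (by norm_num) (by norm_num) (by norm_num)
    · have h1 : odlPT ((1 / 2 : ℝ) • w 0 + (1 / 2 : ℝ) • ω') =
          (1 / 2 : ℝ) • odlPT (w 0) + (1 / 2 : ℝ) • odlPT ω' := by
        ext i j
        simp only [odlPT, Matrix.of_apply, Matrix.add_apply, Matrix.smul_apply,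
          Finset.sum_add_distrib, Finset.smul_sum]
      rw [h1, (hw 0).2, hp', ← add_smul]; norm_num
    · intro F hF
      have h0 := odl_trR_nonneg hF (hw 0).1.1
      have h1 := odl_trR_nonneg hF hs'.1
      simp only [odl_trR_add_right, odl_trR_smul_right]
      obtain ⟨g1, g2⟩ := h' F hF
      refine ⟨fun k hk => ?_, ?_⟩
      · rcases k with _ | k
        · simp only [zero_add, pow_one]; linarith
        · have := g1 k (by omega)
          rw [pow_succ]; linarith
      · rw [pow_succ]; linarith

open scoped Kronecker in
lemma odl_inf {n m : ℕ} (l₀ : Fin m) {ρ σ : Matrix (Fin n) (Fin n) ℂ}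
    (hσ : IsState σ) {K : ℝ} (hK : 1 ≤ K) (hd : (K • σ - ρ).PosSemidef)
    (ψ : Fin n × Fin m → ℂ) (hψ : odlPT (ketbra ψ) = ρ) :
    ∃ ω : Matrix (Fin n × Fin m) (Fin n × Fin m) ℂ, (IsState ω ∧ odlPT ω = σ) ∧
      ∀ F : Matrix (Fin n × Fin m) (Fin n × Fin m) ℂ, F.PosSemidef →
        trR F (ketbra ψ) ≤ K * trR F ω := by
  have hK0 : 0 < K := by linarith
  set E : Matrix (Fin m) (Fin m) ℂ := diagonal (Pi.single l₀ 1) with hE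
  have hEp : E.PosSemidef := by
    refine Matrix.posSemidef_diagonal_iff.2 fun i => ?_
    by_cases h : i = l₀
    · subst h; simp
    · simp [h]
  have hrest : ((K • σ - ρ) ⊗ₖ E).PosSemidef := hd.kronecker hEp
  have hpt : odlPT (K⁻¹ • (ketbra ψ + (K • σ - ρ) ⊗ₖ E)) = σ := by
    have h1 : odlPT (K⁻¹ • (ketbra ψ + (K • σ - ρ) ⊗ₖ E)) =
        K⁻¹ • (odlPT (ketbra ψ) + (K • σ - ρ)) := by
      ext i j
      simp only [odlPT, Matrix.of_apply, Matrix.add_apply, Matrix.smul_apply,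
          Finset.sum_add_distrib, ← Finset.smul_sum, Matrix.kroneckerMap_apply, hE,
          Matrix.diagonal_apply_eq, ← Finset.mul_sum]
      simp
    rw [h1, hψ, add_sub_cancel, smul_smul, inv_mul_cancel₀ hK0.ne', one_smul]
  refine ⟨K⁻¹ • (ketbra ψ + (K • σ - ρ) ⊗ₖ E), ⟨⟨?_, ?_⟩, hpt⟩, ?_⟩
  · exact ((odl_ketbra_psd ψ).add hrest).smul (inv_nonneg.2 hK0.le)
  · rw [← odl_pt_trace, hpt, hσ.2]
  · intro F hF
    have := odl_trR_nonneg hF hrest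
    rw [odl_trR_smul_right, odl_trR_add_right, mul_inv_cancel_left₀ hK0.ne']
    linarith

/-- Observational divergence lifting. -/
theorem observational_divergence_lifting {n m : ℕ} (hnm : n ≤ m)
    (ρ σ : Matrix (Fin n) (Fin n) ℂ) (hρ : IsState ρ) (hσ : IsState σ)
    (hsupp : SuppLE ρ σ)
    (ψ : Fin n × Fin m → ℂ) (hψunit : ∑ p, Complex.normSq (ψ p) = 1)
    (hψpur : ∀ i j : Fin n, ∑ l : Fin m, ψ (i, l) * (starRingEnd ℂ) (ψ (j, l)) = ρ i j) :
    ∃ ω : Matrix (Fin n × Fin m) (Fin n × Fin m) ℂ, IsState ω ∧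
      (∀ i j : Fin n, ∑ l : Fin m, ω (i, l) (j, l) = σ i j) ∧
      obsDiv (ketbra ψ) ω <
        obsDiv ρ σ + 4 * Real.sqrt (obsDiv ρ σ + 1) +
          2 * Real.logb 2 (obsDiv ρ σ + 1) + 4 ∧
      ∀ F : Matrix (Fin n × Fin m) (Fin n × Fin m) ℂ, IsPOVMElem F →
        trR F ω ≠ 0 →
        trR F (ketbra ψ) * Real.logb 2 (trR F (ketbra ψ) / trR F ω) <
          obsDiv ρ σ + 4 * Real.sqrt (obsDiv ρ σ + 1) +
            2 * Real.logb 2 (obsDiv ρ σ + 1) + 4 := by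
  classical
  have hψpt : odlPT (ketbra ψ) = ρ := by
    ext i j
    simp only [odlPT, ketbra, Matrix.of_apply]
    exact hψpur i j
  have hψs : IsState (ketbra ψ) := by
    refine ⟨odl_ketbra_psd ψ, ?_⟩
    rw [← odl_pt_trace, hψpt, hρ.2]
  obtain ⟨l₀⟩ : Nonempty (Fin m) := by
    by_contra hne
    rw [not_nonempty_iff] at hne
    have : IsEmpty (Fin n × Fin m) := inferInstance
    simp at hψunit
  obtain ⟨K, hK, hd⟩ := odl_domination hρ hσ hsupp
  have hD := odl_obsDiv_nonneg hρ hσ hK hd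
  set D := obsDiv ρ σ with hDdef
  set x := Real.sqrt (D + 1) with hxdef
  have hxD : x ^ 2 = D + 1 := Real.sq_sqrt (by linarith)
  have hx : 1 ≤ x := by rw [hxdef, Real.one_le_sqrt]; linarith
  have hx0 : 0 < x := by linarith
  obtain ⟨r, hr⟩ : ∃ r : ℝ, r = 1 + 1 / x := ⟨_, rfl⟩
  have hr1 : 1 < r := by
    rw [hr]
    have : 0 < 1 / x := by positivity
    linarith
  have hr0 : 0 < r := by linarith
  obtain ⟨y, hy⟩ : ∃ y : ℝ, y = Real.sqrt r := ⟨_, rfl⟩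
  have hy0 : 0 < y := by rw [hy]; exact Real.sqrt_pos.2 hr0
  have hyr : y ^ 2 = r := by rw [hy]; exact Real.sq_sqrt hr0.le
  have hy1 : 1 < y := by nlinarith
  have hyi1 : y⁻¹ < 1 := inv_lt_one_of_one_lt₀ hy1
  have hyi0 : 0 < y⁻¹ := inv_pos.2 hy0
  have hex : ∀ k : ℕ, ∃ ω : Matrix (Fin n × Fin m) (Fin n × Fin m) ℂ,
      (IsState ω ∧ odlPT ω = σ) ∧
      ∀ F, IsPOVMElem F → ((y⁻¹) ^ (k + 1)) ^ 2 ≤ trR F (ketbra ψ) →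
        ((y⁻¹) ^ (k + 1) - (y⁻¹) ^ (k + 2)) ^ 2 *
          (((y⁻¹) ^ (k + 2)) ^ 2 * (2 : ℝ) ^ (-(D / ((y⁻¹) ^ (k + 2)) ^ 2))) ≤ trR F ω := by
    intro k
    obtain ⟨ω, h1, h2, h3⟩ := odl_single l₀ hρ hσ hK hd ψ hψpt hψs
      (α := (y⁻¹) ^ (k + 2)) (β := (y⁻¹) ^ (k + 1)) (by positivity)
      (pow_lt_pow_right_of_lt_one₀ hyi0 hyi1 (by omega)) (pow_le_one₀ hyi0.le hyi1.le)
    exact ⟨ω, ⟨h1, h2⟩, h3⟩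
  choose w hw hwF using hex
  obtain ⟨ωi, hωi, hωiF⟩ := odl_inf l₀ hσ hK hd ψ hψpt
  have hri1 : r⁻¹ < 1 := inv_lt_one_of_one_lt₀ hr1
  have hri0 : 0 < r⁻¹ := inv_pos.2 hr0
  have hLK : 0 ≤ Real.logb 2 K := Real.logb_nonneg (by norm_num) hK
  obtain ⟨N, hN⟩ : ∃ N : ℕ, (r⁻¹) ^ N < 1 / (Real.logb 2 K + 1) :=
    exists_pow_lt_of_lt_one (by positivity) hri1
  obtain ⟨ω, ⟨hωs, hωpt⟩, hωF⟩ := odl_mix ωi hωi N w hw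
  set W := D * r ^ 2 + max (1 + Real.logb 2 96 + Real.logb 2 (D + 1)) (2 + 2 * x) with hW
  have hWlt : W < D + 4 * x + 2 * Real.logb 2 (D + 1) + 4 := odl_final_bound hD hx hxD hr
  have hW1 : 2 * x + 1 ≤ W := by
    have h1 : 2 + 2 * x ≤ max (1 + Real.logb 2 96 + Real.logb 2 (D + 1)) (2 + 2 * x) :=
      le_max_right _ _
    have h2 : 0 ≤ D * r ^ 2 := by positivity
    linarith
  have main : ∀ F : Matrix (Fin n × Fin m) (Fin n × Fin m) ℂ, IsPOVMElem F →
        trR F ω ≠ 0 → trR F (ketbra ψ) * Real.logb 2 (trR F (ketbra ψ) / trR F ω) ≤ W := by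
    intro F hF hne
    obtain ⟨p0, p1⟩ := odl_povm_trR hF hψs
    have hτ : 0 < trR F ω := lt_of_le_of_ne (odl_povm_trR hF hωs).1 hne.symm
    obtain ⟨hmix, hmixi⟩ := hωF F hF.1
    have hKF := hωiF F hF.1
    have hwk := fun k => hwF k F hF
    generalize trR F (ketbra ψ) = p at *
    generalize trR F ω = τ at *
    rcases p0.eq_or_lt with hz | hp
    · rw [← hz, zero_mul]; linarith
    rcases le_or_gt p ((r⁻¹) ^ N) with hsmall | hbig
    · have hkN : (N : ℝ) ≤ x * -Real.logb 2 p := odl_k_bound hx hp (by rw [← hr]; exact hsmall)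
      have hle : p / τ ≤ 2 ^ N * K := by
        rw [div_le_iff₀ hτ]
        have e1 : (2 : ℝ) ^ N * (1 / 2) ^ N = 1 := by rw [← mul_pow]; norm_num
        have e2 : trR F ωi ≤ 2 ^ N * τ := by
          have := mul_le_mul_of_nonneg_left hmixi (by positivity : (0 : ℝ) ≤ 2 ^ N)
          rwa [← mul_assoc, e1, one_mul] at this
        nlinarith
      have hlog : Real.logb 2 (p / τ) ≤ N + Real.logb 2 K := by
        have := Real.logb_le_logb_of_le (b := 2) (by norm_num) (by positivity) hle
        rwa [Real.logb_mul (by positivity) (by positivity), Real.logb_pow,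
          Real.logb_self_eq_one (by norm_num), mul_one] at this
      have hpl := odl_neg_mul_logb hp p1
      have h1 := mul_le_mul_of_nonneg_left hlog hp.le
      have h2 : p * N ≤ 2 * x := by
        calc p * N ≤ p * (x * -Real.logb 2 p) := by gcongr
          _ = x * (p * -Real.logb 2 p) := by ring
          _ ≤ x * (2 * (1 - p)) := by gcongr
          _ ≤ 2 * x := by nlinarith
      have h3 : p * Real.logb 2 K ≤ 1 := by
        have h4 : p ≤ 1 / (Real.logb 2 K + 1) := hsmall.trans hN.le
        rw [le_div_iff₀ (by positivity)] at h4
        linarith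
      linarith
    · obtain ⟨k, hk1, hk2⟩ := exists_nat_pow_near_of_lt_one hp p1 hri0 hri1
      have hkN : k < N := by
        by_contra hc
        push Not at hc
        have := pow_le_pow_of_le_one hri0.le hri1.le hc
        linarith
      have hb2 : ((y⁻¹) ^ (k + 1)) ^ 2 = (r⁻¹) ^ (k + 1) := by
        rw [← pow_mul, mul_comm (k + 1) 2, pow_mul, inv_pow, hyr]
      have ha2 : ((y⁻¹) ^ (k + 2)) ^ 2 = (r⁻¹) ^ (k + 1) / r := by
        rw [← pow_mul, mul_comm (k + 2) 2, pow_mul, inv_pow, hyr, pow_succ, div_eq_mul_inv]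
      have h1 := hwk k (by rw [hb2]; exact hk1.le)
      have h2 := hmix k hkN
      have hdiff : ((y⁻¹) ^ (k + 1) - (y⁻¹) ^ (k + 2)) ^ 2 =
          (r⁻¹) ^ (k + 1) * (1 - 1 / y) ^ 2 := by
        rw [← hb2, ← mul_pow]
        congr 1
        rw [one_div]; ring
      rw [hdiff, ha2] at h1
      have hb0 : 0 < (r⁻¹) ^ (k + 1) := by positivity
      have hDb : D / ((r⁻¹) ^ (k + 1) / r) = D * r / (r⁻¹) ^ (k + 1) := by
        field_simp
      rw [hDb] at h1
      refine odl_numeric (k := k) (b := (r⁻¹) ^ (k + 1)) hD hx hxD hr hy0 hyr hp p1 hτ hk2 rfl ?_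
      refine le_trans ?_ h2
      gcongr
  refine ⟨ω, hωs, fun i j => ?_, ?_, fun F hF hne => (main F hF hne).trans_lt hWlt⟩
  · have := congrFun (congrFun hωpt i) j
    simpa [odlPT] using this
  · refine lt_of_le_of_lt (csSup_le ?_ ?_) hWlt
    · exact ⟨_, 1, odl_povm_one, by rw [odl_trR_one hωs]; norm_num, rfl⟩
    · rintro z ⟨F, hF, hne, rfl⟩
      exact main F hF hne

end
end
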